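/- The only pairs (a, z) ∈ ℚ × ℚ satisfying a³z³ − a³z² + 3a²z³ − 2a²z + 3az³ + 2az² − 2az − a + z³ + 2z² − z − 1 = 0 are (a, z) = (−1, 0) and (a, z) = (−1, 1). Consequently, for a ∈ ℚ \ {0, −1, −2}, the map φ_a has no rational periodic point of period 3 outside its critical 3-cycle {0, ∞, 1}. -/

import Mathlib

section PF1
set_option linter.unusedVariables false

/-- Coefficientwise form of `V^2 + m n V - m^2 d^2 = U W`. -/
structure QRel {R : Type*} [CommRing R] (u0 u1 u2 v0 v1 v2 v3 m w0 w1 w2 w3 w4 : R) : Prop where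
  h6 : v3^2 + m*v3 = u2*w4
  h5 : 2*v3*v2 + m*(v2+v3) = u2*w3+u1*w4
  h4 : v2^2 + 2*v3*v1 + m*(v1+v2-2*v3) - m^2 = u2*w2+u1*w3+u0*w4
  h3 : 2*v3*v0 + 2*v2*v1 + m*(v0+v1-2*v2-v3) - 2*m^2 = u2*w1+u1*w2+u0*w3
  h2 : v1^2 + 2*v2*v0 + m*(v0-2*v1-v2) - m^2 = u2*w0+u1*w1+u0*w2
  h1 : 2*v1*v0 + m*(-2*v0-v1) = u1*w0+u0*w1
  h0 : v0^2 - m*v0 = u0*w0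

lemma QRel.map {R S : Type*} [CommRing R] [CommRing S] (f : R →+* S) {u0 u1 u2 v0 v1 v2 v3 m w0 w1 w2 w3 w4 : R}
    (h : QRel u0 u1 u2 v0 v1 v2 v3 m w0 w1 w2 w3 w4) :
    QRel (f u0) (f u1) (f u2) (f v0) (f v1) (f v2) (f v3) (f m) (f w0) (f w1) (f w2) (f w3) (f w4) := by
  obtain ⟨h6, h5, h4, h3, h2, h1, h0⟩ := h
  constructor
  · simpa [map_ofNat] using congrArg f h6
  · simpa [map_ofNat] using congrArg f h5
  · simpa [map_ofNat] using congrArg f h4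
  · simpa [map_ofNat] using congrArg f h3
  · simpa [map_ofNat] using congrArg f h2
  · simpa [map_ofNat] using congrArg f h1
  · simpa [map_ofNat] using congrArg f h0

lemma QRel.eval2 {R : Type*} [CommRing R] {u0 u1 u2 v0 v1 v2 v3 m w0 w1 w2 w3 w4 : R}
    (h : QRel u0 u1 u2 v0 v1 v2 v3 m w0 w1 w2 w3 w4) (x z : R) :
    (v0*z^3+v1*x*z^2+v2*x^2*z+v3*x^3)^2 + m*(x^3+x^2*z-2*x*z^2-z^3)*(v0*z^3+v1*x*z^2+v2*x^2*z+v3*x^3)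
      - m^2*(x*z*(x+z))^2 = (u0*z^2+u1*x*z+u2*x^2)*(w0*z^4+w1*x*z^3+w2*x^2*z^2+w3*x^3*z+w4*x^4) := by
  obtain ⟨h6, h5, h4, h3, h2, h1, h0⟩ := h
  linear_combination x^6*h6+x^5*z*h5+x^4*z^2*h4+x^3*z^3*h3+x^2*z^4*h2+x*z^5*h1+z^6*h0

lemma QRel.eval {R : Type*} [CommRing R] {u0 u1 u2 v0 v1 v2 v3 m w0 w1 w2 w3 w4 : R}
    (h : QRel u0 u1 u2 v0 v1 v2 v3 m w0 w1 w2 w3 w4) (x : R) :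
    (v0+v1*x+v2*x^2+v3*x^3)^2 + m*(x^3+x^2-2*x-1)*(v0+v1*x+v2*x^2+v3*x^3)
      - m^2*(x*(x+1))^2 = (u0+u1*x+u2*x^2)*(w0+w1*x+w2*x^2+w3*x^3+w4*x^4) := by
  linear_combination h.eval2 x 1

lemma QRel.deriv {R : Type*} [CommRing R] {u0 u1 u2 v0 v1 v2 v3 m w0 w1 w2 w3 w4 : R}
    (h : QRel u0 u1 u2 v0 v1 v2 v3 m w0 w1 w2 w3 w4) (x : R) :
    2*(v0+v1*x+v2*x^2+v3*x^3)*(v1+2*v2*x+3*v3*x^2) + m*(3*x^2+2*x-2)*(v0+v1*x+v2*x^2+v3*x^3)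
      + m*(x^3+x^2-2*x-1)*(v1+2*v2*x+3*v3*x^2)
      - 2*m^2*(x*(x+1))*(2*x+1) = (u1+2*u2*x)*(w0+w1*x+w2*x^2+w3*x^3+w4*x^4)
        + (u0+u1*x+u2*x^2)*(w1+2*w2*x+3*w3*x^2+4*w4*x^3) := by
  obtain ⟨h6, h5, h4, h3, h2, h1, h0⟩ := h
  linear_combination 6*x^5*h6+5*x^4*h5+4*x^3*h4+3*x^2*h3+2*x*h2+h1

lemma gauss_field {F : Type*} [Field F] {u0 u1 u2 w0 w1 w2 w3 w4 : F} (hu : ¬ (u0 = 0 ∧ u1 = 0 ∧ u2 = 0))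
   (h6 : u2*w4 = 0) (h5 : u2*w3+u1*w4 = 0) (h4 : u2*w2+u1*w3+u0*w4 = 0)
   (h3 : u2*w1+u1*w2+u0*w3 = 0) (h2 : u2*w0+u1*w1+u0*w2 = 0) (h1 : u1*w0+u0*w1 = 0) (h0 : u0*w0 = 0) :
   w0 = 0 ∧ w1 = 0 ∧ w2 = 0 ∧ w3 = 0 ∧ w4 = 0 := by
  by_cases k0 : u0 = 0
  · subst k0
    by_cases k1 : u1 = 0
    · subst k1
      have k2 : u2 ≠ 0 := by tauto
      simp_all
    · simp only [zero_mul, add_zero, mul_eq_zero, k1, false_or] at h0 h1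
      subst h1
      simp only [mul_zero, zero_add, zero_mul, add_zero, mul_eq_zero, k1, false_or] at h2
      subst h2
      simp only [mul_zero, zero_add, zero_mul, add_zero, mul_eq_zero, k1, false_or] at h3
      subst h3
      simp only [mul_zero, zero_add, zero_mul, add_zero, mul_eq_zero, k1, false_or] at h4
      subst h4
      simp only [mul_zero, zero_add, zero_mul, add_zero, mul_eq_zero, k1, false_or] at h5
      tauto
  · simp only [mul_eq_zero, k0, false_or] at h0
    subst h0
    simp only [mul_zero, zero_add, zero_mul, add_zero, mul_eq_zero, k0, false_or] at h1
    subst h1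
    simp only [mul_zero, zero_add, zero_mul, add_zero, mul_eq_zero, k0, false_or] at h2
    subst h2
    simp only [mul_zero, zero_add, zero_mul, add_zero, mul_eq_zero, k0, false_or] at h3
    subst h3
    simp only [mul_zero, zero_add, zero_mul, add_zero, mul_eq_zero, k0, false_or] at h4
    tauto

lemma zm_dvd {p : ℕ} (a : ℤ) : ((a : ZMod p) = 0) ↔ (p:ℤ) ∣ a := ZMod.intCast_zmod_eq_zero_iff_dvd a p |>.trans Iff.rfl

lemma gauss_int {p : ℕ} (hp : p.Prime) {u0 u1 u2 w0 w1 w2 w3 w4 : ℤ} (hu : ¬ ((p:ℤ) ∣ u0 ∧ (p:ℤ) ∣ u1 ∧ (p:ℤ) ∣ u2))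
   (h6 : (p:ℤ) ∣ u2*w4) (h5 : (p:ℤ) ∣ u2*w3+u1*w4) (h4 : (p:ℤ) ∣ u2*w2+u1*w3+u0*w4)
   (h3 : (p:ℤ) ∣ u2*w1+u1*w2+u0*w3) (h2 : (p:ℤ) ∣ u2*w0+u1*w1+u0*w2) (h1 : (p:ℤ) ∣ u1*w0+u0*w1) (h0 : (p:ℤ) ∣ u0*w0) :
   (p:ℤ) ∣ w0 ∧ (p:ℤ) ∣ w1 ∧ (p:ℤ) ∣ w2 ∧ (p:ℤ) ∣ w3 ∧ (p:ℤ) ∣ w4 := by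
  have := Fact.mk hp
  simp only [← zm_dvd] at *
  push_cast at *
  exact gauss_field hu h6 h5 h4 h3 h2 h1 h0

/-- Division of `V` by `U` when all three share a root and `V^2 = U W`. -/
lemma divU {F κ : Type*} [Field F] [CommRing κ] [IsDomain κ] (φ : F →+* κ) (t : κ)
    {u0 u1 u2 v0 v1 v2 v3 w0 w1 w2 w3 w4 : F} (h : QRel u0 u1 u2 v0 v1 v2 v3 0 w0 w1 w2 w3 w4)
    (hu : ¬ (u0 = 0 ∧ u1 = 0 ∧ u2 = 0))
    (hU : φ u0 + φ u1 * t + φ u2 * t^2 = 0)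
    (hV : φ v0 + φ v1 * t + φ v2 * t^2 + φ v3 * t^3 = 0)
    (hW : φ w0 + φ w1 * t + φ w2 * t^2 + φ w3 * t^3 + φ w4 * t^4 = 0) :
    ∃ l0 l1 : F, v3 = l1*u2 ∧ v2 = l1*u1+l0*u2 ∧ v1 = l1*u0+l0*u1 ∧ v0 = l0*u0 := by
  obtain ⟨h6, h5, h4, h3, h2, h1, h0⟩ := h
  by_cases k2 : u2 = 0
  · subst k2
    have k1 : u1 ≠ 0 := by
      rintro rfl
      simp at hU
      exact hu ⟨hU, rfl, rfl⟩
    have e3 : v3 = 0 := by simpa using h6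
    subst e3
    refine ⟨(v1 - v2/u1*u0)/u1, v2/u1, by ring, by field_simp; ring, by field_simp; ring, ?_⟩
    rw [← sub_eq_zero]
    apply (map_eq_zero φ).1
    have : v0 - (v1 - v2/u1*u0)/u1*u0 = v0 - (v1 - v2/u1*u0)/u1*u0 := rfl
    set l1 := v2/u1 with hl1
    set l0 := (v1 - l1*u0)/u1 with hl0
    have a1 : v2 = l1*u1 := by rw [hl1]; field_simp
    have a2 : v1 = l1*u0+l0*u1 := by rw [hl0]; field_simp; ring
    rw [a1, a2] at hV
    simp only [map_add, map_mul, map_sub, map_zero] at hV hU ⊢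
    linear_combination hV - (φ l1 * t + φ l0)*hU
  · set l1 := v3/u2 with hl1
    set l0 := (v2 - l1*u1)/u2 with hl0
    have a1 : v3 = l1*u2 := by rw [hl1]; field_simp
    have a2 : v2 = l1*u1+l0*u2 := by rw [hl0]; field_simp; ring
    obtain ⟨r1, hr1⟩ : ∃ r1, v1 = l1*u0+l0*u1 + r1 := ⟨v1 - (l1*u0+l0*u1), by ring⟩
    obtain ⟨r0, hr0⟩ : ∃ r0, v0 = l0*u0+r0 := ⟨v0 - l0*u0, by ring⟩
    clear_value l0 l1
    subst a1 a2 hr1 hr0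
    -- W' = W - 2 l V + l^2 U = W - 2 l R - l^2 U
    have b4 : w4 - l1^2*u2 = 0 := by
      apply mul_left_cancel₀ k2; linear_combination -h6
    have b3 : w3 - (l1^2*u1+2*l1*l0*u2) = 0 := by
      apply mul_left_cancel₀ k2; linear_combination -h5 - u1*b4
    have b2 : w2 - 2*l1*r1 - (l1^2*u0+2*l1*l0*u1+l0^2*u2) = 0 := by
      apply mul_left_cancel₀ k2; linear_combination -h4 - u1*b3-u0*b4
    have b1 : w1 - 2*l1*r0-2*l0*r1 - (2*l1*l0*u0+l0^2*u1) = 0 := by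
      apply mul_left_cancel₀ k2; linear_combination -h3 - u1*b2-u0*b3
    have b0 : w0 - 2*l0*r0 - l0^2*u0 = 0 := by
      apply (map_eq_zero φ).1
      have c4 := congrArg φ b4
      have c3 := congrArg φ b3
      have c2 := congrArg φ b2
      have c1 := congrArg φ b1
      simp only [map_add, map_mul, map_sub, map_zero, map_pow, map_ofNat] at *
      linear_combination hW - 2*(φ l1 * t + φ l0)*hV + (φ l1 * t + φ l0)^2 * hU - t^4*c4-t^3*c3-t^2*c2-t*c1
    have d1 : r1^2 = 0 := by linear_combination h2 + u2*b0+u1*b1+u0*b2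
    have d0 : r0^2 = 0 := by linear_combination h0 + u0*b0
    have d1 := pow_eq_zero_iff (two_ne_zero) |>.1 d1
    have d0 := pow_eq_zero_iff (two_ne_zero) |>.1 d0
    subst d1 d0
    exact ⟨l0, l1, rfl, rfl, by ring, by ring⟩

lemma reduce_step {p : ℕ} (hp : p.Prime) {u0 u1 u2 v0 v1 v2 v3 m w0 w1 w2 w3 w4 : ℤ}
    (h : QRel u0 u1 u2 v0 v1 v2 v3 (p*m) w0 w1 w2 w3 w4)
    (hu : ¬ ((p:ℤ) ∣ u0 ∧ (p:ℤ) ∣ u1 ∧ (p:ℤ) ∣ u2)) (l0 l1 : ℤ)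
    (a3 : (p:ℤ) ∣ v3 - l1*u2) (a2 : (p:ℤ) ∣ v2 - (l1*u1+l0*u2)) (a1 : (p:ℤ) ∣ v1 - (l1*u0+l0*u1))
    (a0 : (p:ℤ) ∣ v0 - l0*u0) :
    ∃ v0 v1 v2 v3 w0 w1 w2 w3 w4, QRel u0 u1 u2 v0 v1 v2 v3 m w0 w1 w2 w3 w4 := by
  obtain ⟨x3, a3⟩ := a3
  obtain ⟨x2, a2⟩ := a2
  obtain ⟨x1, a1⟩ := a1
  obtain ⟨x0, a0⟩ := a0
  have hpz : (p:ℤ) ≠ 0 := by exact_mod_cast hp.ne_zero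
  generalize hP : (p:ℤ) = P at *
  obtain rfl : v3 = P*x3 + l1*u2 := by linear_combination a3
  obtain rfl : v2 = P*x2 + (l1*u1+l0*u2) := by linear_combination a2
  obtain rfl : v1 = P*x1 + (l1*u0+l0*u1) := by linear_combination a1
  obtain rfl : v0 = P*x0 + l0*u0 := by linear_combination a0
  obtain ⟨h6, h5, h4, h3, h2, h1, h0⟩ := h
  -- W0 = W - 2 l V0 - l^2 U - m n l
  obtain ⟨y4, hy4⟩ : ∃ y, y = w4 - 2*l1*(P*x3) - l1^2*u2 - P*m*l1 := ⟨_, rfl⟩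
  obtain ⟨y3, hy3⟩ : ∃ y, y = w3 - 2*(l1*(P*x2)+l0*(P*x3)) - (l1^2*u1+2*l1*l0*u2) - P*m*(l1+l0) := ⟨_, rfl⟩
  obtain ⟨y2, hy2⟩ : ∃ y, y = w2 - 2*(l1*(P*x1)+l0*(P*x2)) - (l1^2*u0+2*l1*l0*u1+l0^2*u2) - P*m*(-2*l1+l0) := ⟨_, rfl⟩
  obtain ⟨y1, hy1⟩ : ∃ y, y = w1 - 2*(l1*(P*x0)+l0*(P*x1)) - (2*l1*l0*u0+l0^2*u1) - P*m*(-l1-2*l0) := ⟨_, rfl⟩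
  obtain ⟨y0, hy0⟩ : ∃ y, y = w0 - 2*l0*(P*x0) - l0^2*u0 - P*m*(-l0) := ⟨_, rfl⟩
  have k6 : u2*y4 = P*(P*(x3^2 + m*x3)) := by subst_vars; linear_combination -h6
  have k5 : u2*y3+u1*y4 = P*(P*(2*x3*x2 + m*(x2+x3))) := by subst_vars; linear_combination -h5
  have k4 : u2*y2+u1*y3+u0*y4 = P*(P*(x2^2 + 2*x3*x1 + m*(x1+x2-2*x3) - m^2)) := by subst_vars; linear_combination -h4
  have k3 : u2*y1+u1*y2+u0*y3 = P*(P*(2*x3*x0 + 2*x2*x1 + m*(x0+x1-2*x2-x3) - 2*m^2)) := by subst_vars; linear_combination -h3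
  have k2 : u2*y0+u1*y1+u0*y2 = P*(P*(x1^2 + 2*x2*x0 + m*(x0-2*x1-x2) - m^2)) := by subst_vars; linear_combination -h2
  have k1 : u1*y0+u0*y1 = P*(P*(2*x1*x0 + m*(-2*x0-x1))) := by subst_vars; linear_combination -h1
  have k0 : u0*y0 = P*(P*(x0^2 - m*x0)) := by subst_vars; linear_combination -h0
  clear hy0 hy1 hy2 hy3 hy4 h0 h1 h2 h3 h4 h5 h6 a0 a1 a2 a3
  have g1 := gauss_int hp (by rw [hP]; exact hu) (by rw [hP]; exact ⟨_, k6⟩) (by rw [hP]; exact ⟨_, k5⟩) (by rw [hP]; exact ⟨_, k4⟩)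
    (by rw [hP]; exact ⟨_, k3⟩) (by rw [hP]; exact ⟨_, k2⟩) (by rw [hP]; exact ⟨_, k1⟩) (by rw [hP]; exact ⟨_, k0⟩)
  rw [hP] at g1
  obtain ⟨⟨y0, rfl⟩, ⟨y1, rfl⟩, ⟨y2, rfl⟩, ⟨y3, rfl⟩, ⟨y4, rfl⟩⟩ := g1
  have k6 : u2*y4 = P*((x3^2 + m*x3)) := by apply mul_left_cancel₀ hpz; linear_combination k6
  have k5 : u2*y3+u1*y4 = P*((2*x3*x2 + m*(x2+x3))) := by apply mul_left_cancel₀ hpz; linear_combination k5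
  have k4 : u2*y2+u1*y3+u0*y4 = P*((x2^2 + 2*x3*x1 + m*(x1+x2-2*x3) - m^2)) := by apply mul_left_cancel₀ hpz; linear_combination k4
  have k3 : u2*y1+u1*y2+u0*y3 = P*((2*x3*x0 + 2*x2*x1 + m*(x0+x1-2*x2-x3) - 2*m^2)) := by apply mul_left_cancel₀ hpz; linear_combination k3
  have k2 : u2*y0+u1*y1+u0*y2 = P*((x1^2 + 2*x2*x0 + m*(x0-2*x1-x2) - m^2)) := by apply mul_left_cancel₀ hpz; linear_combination k2
  have k1 : u1*y0+u0*y1 = P*((2*x1*x0 + m*(-2*x0-x1))) := by apply mul_left_cancel₀ hpz; linear_combination k1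
  have k0 : u0*y0 = P*((x0^2 - m*x0)) := by apply mul_left_cancel₀ hpz; linear_combination k0
  have g1 := gauss_int hp (by rw [hP]; exact hu) (by rw [hP]; exact ⟨_, k6⟩) (by rw [hP]; exact ⟨_, k5⟩) (by rw [hP]; exact ⟨_, k4⟩)
    (by rw [hP]; exact ⟨_, k3⟩) (by rw [hP]; exact ⟨_, k2⟩) (by rw [hP]; exact ⟨_, k1⟩) (by rw [hP]; exact ⟨_, k0⟩)
  rw [hP] at g1
  obtain ⟨⟨y0, rfl⟩, ⟨y1, rfl⟩, ⟨y2, rfl⟩, ⟨y3, rfl⟩, ⟨y4, rfl⟩⟩ := g1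
  refine ⟨x0, x1, x2, x3, y0, y1, y2, y3, y4, ⟨?_, ?_, ?_, ?_, ?_, ?_, ?_⟩⟩
  · apply mul_left_cancel₀ hpz; linear_combination -k6
  · apply mul_left_cancel₀ hpz; linear_combination -k5
  · apply mul_left_cancel₀ hpz; linear_combination -k4
  · apply mul_left_cancel₀ hpz; linear_combination -k3
  · apply mul_left_cancel₀ hpz; linear_combination -k2
  · apply mul_left_cancel₀ hpz; linear_combination -k1
  · apply mul_left_cancel₀ hpz; linear_combination -k0

end PF1

section PNF1
open Polynomial

noncomputable def hpZ : ℤ[X] := X^6 + 2*X^5 + 3*X^4 + 4*X^3 + 4*X^2 + 2*X + 1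

lemma hpZ_natDegree : hpZ.natDegree = 6 := by
  unfold hpZ; compute_degree!

lemma hpZ_monic : hpZ.Monic := by
  unfold hpZ; monicity!

noncomputable def hp3 : (ZMod 3)[X] := X^6 + 2*X^5 + 3*X^4 + 4*X^3 + 4*X^2 + 2*X + 1

instance fact_three : Fact (Nat.Prime 3) := ⟨Nat.prime_three⟩

lemma hp3_natDegree : hp3.natDegree = 6 := by
  unfold hp3; compute_degree!

lemma hp3_monic : hp3.Monic := by
  unfold hp3; monicity!

lemma hp3_coeff (k : ℕ) : hp3.coeff k = if k = 0 then 1 else if k = 1 then 2 else if k = 2 then 4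
    else if k = 3 then 4 else if k = 4 then 3 else if k = 5 then 2 else if k = 6 then 1 else 0 := by
  have : hp3 = X^6 + C 2*X^5 + C 3*X^4 + C 4*X^3 + C 4*X^2 + C 2*X + C 1 := by
    unfold hp3; simp only [map_ofNat, map_one]
  rw [this]
  simp only [coeff_add, coeff_C_mul, coeff_X_pow, coeff_X, coeff_C]
  rcases k with _|_|_|_|_|_|_|k <;> simp

lemma hp3_irr : Irreducible hp3 := by
  have h1 : hp3 ≠ 1 := by
    intro h
    have := hp3_natDegree
    rw [h] at this; simp at this
  rw [hp3_monic.irreducible_iff_natDegree']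
  refine ⟨h1, ?_⟩
  intro f g hf hg hfg hm
  have hd : f.natDegree + g.natDegree = 6 := by
    rw [← hf.natDegree_mul hg, hfg, hp3_natDegree]
  rw [hp3_natDegree] at hm
  simp only [Finset.mem_Ioc] at hm
  have hc : ∀ k, (f*g).coeff k = hp3.coeff k := fun k => by rw [hfg]
  have e0 := hc 0
  have e1 := hc 1
  have e2 := hc 2
  have e3 := hc 3
  have e4 := hc 4
  have e5 := hc 5
  simp only [coeff_mul, Finset.Nat.sum_antidiagonal_eq_sum_range_succ_mk, Finset.sum_range_succ, Finset.sum_range_zero, hp3_coeff] at e0 e1 e2 e3 e4 e5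
  have hfz : ∀ k, f.natDegree < k → f.coeff k = 0 := fun k hk => coeff_eq_zero_of_natDegree_lt hk
  have hgz : ∀ k, g.natDegree < k → g.coeff k = 0 := fun k hk => coeff_eq_zero_of_natDegree_lt hk
  have hfl := hf.coeff_natDegree
  have hgl := hg.coeff_natDegree
  obtain h | h | h : g.natDegree = 1 ∨ g.natDegree = 2 ∨ g.natDegree = 3 := by omega
  · have h' : f.natDegree = 5 := by omega
    rw [h] at hgl hgz; rw [h'] at hfl hfz
    simp [hgz 2, hgz 3, hgz 4, hgz 5, hfl, hgl] at e0 e1 e2 e3 e4 e5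
    generalize f.coeff 0 = f0 at *
    generalize f.coeff 1 = f1 at *
    generalize f.coeff 2 = f2 at *
    generalize f.coeff 3 = f3 at *
    generalize f.coeff 4 = f4 at *
    generalize g.coeff 0 = g0 at *
    clear hc hfz hgz
    have hr : g0^6 - 2*g0^5+3*g0^4-4*g0^3+4*g0^2-2*g0+1 = 0 := by grind
    revert hr; clear * -; revert g0; decide
  · have h' : f.natDegree = 4 := by omega
    rw [h] at hgl hgz; rw [h'] at hfl hfz
    simp [hgz 3, hgz 4, hgz 5, hfz 5, hfl, hgl] at e0 e1 e2 e3 e4 e5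
    generalize f.coeff 0 = f0 at *
    generalize f.coeff 1 = f1 at *
    generalize f.coeff 2 = f2 at *
    generalize f.coeff 3 = f3 at *
    generalize g.coeff 0 = g0 at *
    generalize g.coeff 1 = g1 at *
    have a3 : f3 = 2 - g1 := by linear_combination e5
    subst a3
    have a2 : f2 = 3 - g0 - (2-g1)*g1 := by linear_combination e4
    subst a2
    have a1 : f1 = 4 - (2-g1)*g0 - (3 - g0 - (2-g1)*g1)*g1 := by linear_combination e3
    subst a1
    have a0 : f0 = 4 - (3 - g0 - (2-g1)*g1)*g0 - (4 - (2-g1)*g0 - (3 - g0 - (2-g1)*g1)*g1)*g1 := by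
      linear_combination e2
    subst a0
    revert e0 e1; clear * -; revert g0 g1; decide
  · have h' : f.natDegree = 3 := by omega
    rw [h] at hgl hgz; rw [h'] at hfl hfz
    simp [hgz 4, hgz 5, hfz 4, hfz 5, hfl, hgl] at e0 e1 e2 e3 e4 e5
    generalize f.coeff 0 = f0 at *
    generalize f.coeff 1 = f1 at *
    generalize f.coeff 2 = f2 at *
    generalize g.coeff 0 = g0 at *
    generalize g.coeff 1 = g1 at *
    generalize g.coeff 2 = g2 at *
    have a2 : f2 = 2 - g2 := by linear_combination e5
    subst a2
    have a1 : f1 = 3 - g1 - (2-g2)*g2 := by linear_combination e4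
    subst a1
    have a0 : f0 = 4 - g0 - (2-g2)*g1 - (3 - g1 - (2-g2)*g2)*g2 := by linear_combination e3
    subst a0
    revert e0 e1 e2; clear * -; revert g0 g1 g2; decide

lemma hpZ_irr : Irreducible hpZ := by
  apply Monic.irreducible_of_irreducible_map (Int.castRingHom (ZMod 3)) _ hpZ_monic
  have : hpZ.map (Int.castRingHom (ZMod 3)) = hp3 := by
    unfold hpZ hp3; simp
  rw [this]; exact hp3_irr

noncomputable def hp : ℚ[X] := X^6 + 2*X^5 + 3*X^4 + 4*X^3 + 4*X^2 + 2*X + 1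

lemma hp_eq : hp = hpZ.map (algebraMap ℤ ℚ) := by
  unfold hpZ hp; simp

lemma hp_irr : Irreducible hp := by
  rw [hp_eq]
  exact (hpZ_monic.irreducible_iff_irreducible_map_fraction_map).1 hpZ_irr

lemma hp_monic : hp.Monic := by
  unfold hp; monicity!

lemma hp_natDegree : hp.natDegree = 6 := by
  unfold hp; compute_degree!


theorem exists_fieldM : ∃ (K : Type) (_ : Field K) (_ : NumberField K) (ξ : K),
    ξ^6 + 2*ξ^5 + 3*ξ^4 + 4*ξ^3 + 4*ξ^2 + 2*ξ + 1 = 0 ∧ Module.finrank ℚ K = 6 := by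
  have : Fact (Irreducible hp) := ⟨hp_irr⟩
  have e1 : Module.finrank ℚ (AdjoinRoot hp) = 6 := by
    rw [(AdjoinRoot.powerBasis hp_irr.ne_zero).finrank]
    simp [hp_natDegree]
  have hfd : FiniteDimensional ℚ (AdjoinRoot hp) := (AdjoinRoot.powerBasis hp_irr.ne_zero).finite
  refine ⟨AdjoinRoot hp, inferInstance, ?_, AdjoinRoot.root hp, ?_, ?_⟩
  · exact { to_charZero := inferInstance, to_finiteDimensional := by convert hfd }
  · have := AdjoinRoot.eval₂_root hp
    have h2 : eval₂ (AdjoinRoot.of hp) (AdjoinRoot.root hp) (X^6 + 2*X^5 + 3*X^4 + 4*X^3 + 4*X^2 + 2*X + 1) = 0 := this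
    simpa [eval₂_add, eval₂_mul, eval₂_pow] using h2
  · convert e1

section
variable {K : Type} [Field K] [NumberField K] {ξ : K}

lemma minpolyM (hξ : ξ^6 + 2*ξ^5 + 3*ξ^4 + 4*ξ^3 + 4*ξ^2 + 2*ξ + 1 = 0) : minpoly ℚ ξ = hp := by
  refine (minpoly.eq_of_irreducible_of_monic hp_irr ?_ hp_monic).symm
  unfold hp
  simpa only [map_add, map_mul, map_pow, map_ofNat, aeval_X, map_one] using hξ

/-- linear independence in coordinates -/
lemma xiM_indep (hξ : ξ^6 + 2*ξ^5 + 3*ξ^4 + 4*ξ^3 + 4*ξ^2 + 2*ξ + 1 = 0)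
    (c0 c1 c2 c3 c4 c5 : ℚ)
    (h : (c0:K) + c1 * ξ + c2 * ξ^2 + c3 * ξ^3 + c4 * ξ^4 + c5 * ξ^5 = 0) :
    c0 = 0 ∧ c1 = 0 ∧ c2 = 0 ∧ c3 = 0 ∧ c4 = 0 ∧ c5 = 0 := by
  have key : (C c0 + C c1 * X + C c2 * X^2 + C c3 * X^3 + C c4 * X^4 + C c5 * X^5 : ℚ[X]) = 0 := by
    by_contra hne
    have := natDegree_le_natDegree (minpoly.degree_le_of_ne_zero ℚ ξ hne (by
      simpa [aeval_def] using h))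
    rw [minpolyM hξ, hp_natDegree] at this
    have h2 : (C c0 + C c1 * X + C c2 * X^2 + C c3 * X^3 + C c4 * X^4 + C c5 * X^5 : ℚ[X]).natDegree ≤ 5 := by
      compute_degree
    omega
  have hk : ∀ k, (C c0 + C c1 * X + C c2 * X^2 + C c3 * X^3 + C c4 * X^4 + C c5 * X^5 : ℚ[X]).coeff k = 0 := by
    intro k; rw [key]; simp
  simp only [coeff_add, coeff_C_mul, coeff_X_pow, coeff_X, coeff_C] at hk
  refine ⟨?_, ?_, ?_, ?_, ?_, ?_⟩
  · simpa using hk 0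
  · simpa using hk 1
  · simpa using hk 2
  · simpa using hk 3
  · simpa using hk 4
  · simpa using hk 5

lemma xiM_pb (hξ : ξ^6 + 2*ξ^5 + 3*ξ^4 + 4*ξ^3 + 4*ξ^2 + 2*ξ + 1 = 0)
    (hd : Module.finrank ℚ K = 6) : ∃ pb : PowerBasis ℚ K, pb.gen = ξ ∧ pb.dim = 6 := by
  have hxiInt : IsIntegral ℚ ξ := Algebra.IsIntegral.isIntegral ξ
  have htop : IntermediateField.adjoin ℚ {ξ} = ⊤ := by
    rw [Field.primitive_element_iff_minpoly_natDegree_eq, minpolyM hξ, hp_natDegree, hd]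
  have h2 : Algebra.adjoin ℚ {ξ} = ⊤ := by
    rw [← IntermediateField.adjoin_simple_toSubalgebra_of_isAlgebraic hxiInt.isAlgebraic, htop]; rfl
  refine ⟨PowerBasis.ofAdjoinEqTop hxiInt h2, by simp, ?_⟩
  rw [← hd, PowerBasis.finrank]

lemma xiM_span (hξ : ξ^6 + 2*ξ^5 + 3*ξ^4 + 4*ξ^3 + 4*ξ^2 + 2*ξ + 1 = 0)
    (hd : Module.finrank ℚ K = 6) (z : K) : ∃ c0 c1 c2 c3 c4 c5 : ℚ,
    z = (c0:K) + c1 * ξ + c2 * ξ^2 + c3 * ξ^3 + c4 * ξ^4 + c5 * ξ^5 := by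
  obtain ⟨pb, hg, hdim⟩ := xiM_pb hξ hd
  obtain ⟨f, hdeg, hf⟩ := pb.exists_eq_aeval z
  rw [hg] at hf
  rw [hdim] at hdeg
  rw [aeval_eq_sum_range' hdeg] at hf
  simp only [Finset.sum_range_succ, Finset.sum_range_zero] at hf
  refine ⟨f.coeff 0, f.coeff 1, f.coeff 2, f.coeff 3, f.coeff 4, f.coeff 5, ?_⟩
  rw [hf]
  simp [Algebra.smul_def]

end

end PNF1

section PNF2
open Polynomial NumberField

def hev {R : Type*} [CommRing R] (x : R) : R := x^6 + 2*x^5 + 3*x^4 + 4*x^3 + 4*x^2 + 2*x + 1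

def imP {R : Type*} [CommRing R] (x : R) : R := x^5+2*x^4+3*x^3+3*x^2+3*x+1

lemma imP_sq {R : Type*} [CommRing R] {x : R} (hx : hev x = 0) : imP x ^ 2 = -1 := by
  unfold hev at hx; unfold imP
  linear_combination (x^4 + 2*x^3 + 3*x^2 + 2*x + 2) * hx

lemma map_imP {R S : Type*} [CommRing R] [CommRing S] (f : R →+* S) (x : R) :
    f (imP x) = imP (f x) := by simp only [imP, map_add, map_mul, map_pow, map_ofNat, map_one]

lemma map_hev {R S : Type*} [CommRing R] [CommRing S] (f : R →+* S) (x : R) :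
    f (hev x) = hev (f x) := by simp only [hev, map_add, map_mul, map_pow, map_ofNat, map_one]

set_option linter.unusedSectionVars false

section
variable {K : Type} [Field K] [NumberField K] {x : 𝓞 K}

lemma hev_K (hx : hev x = 0) : hev (x : K) = 0 := by
  have := map_hev (algebraMap (𝓞 K) K) x
  rw [hx] at this
  simpa using this.symm

lemma totComplex (hx : hev x = 0) : IsTotallyComplex K := by
  constructor
  intro v
  by_contra hv
  rw [InfinitePlace.not_isComplex_iff_isReal] at hv
  have h1 := imP_sq (hev_K hx)
  have h2 := congrArg (InfinitePlace.embedding_of_isReal hv) h1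
  simp only [map_pow, map_neg, map_one] at h2
  nlinarith [sq_nonneg (InfinitePlace.embedding_of_isReal hv (imP (x:K)))]

lemma norm_c (hx : hev x = 0) (hd : Module.finrank ℚ K = 6) :
    |Algebra.norm ℚ (5 - 12 * imP (x:K))| = 13^6 := by
  have h := InfinitePlace.prod_eq_abs_norm (5 - 12 * imP (x:K))
  have hw : ∀ w : InfinitePlace K, w (5 - 12 * imP (x:K)) = 13 := by
    intro w
    rw [← InfinitePlace.norm_embedding_eq]
    have h1 := imP_sq (hev_K hx)
    have h2 := congrArg w.embedding h1
    simp only [map_pow, map_neg, map_one] at h2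
    have h3 : (w.embedding (imP (x:K)) - Complex.I) * (w.embedding (imP (x:K)) + Complex.I) = 0 := by
      linear_combination h2 - Complex.I_sq
    simp only [map_sub, map_mul, map_ofNat]
    rcases mul_eq_zero.1 h3 with h | h
    · rw [sub_eq_zero.1 h]
      rw [show (13:ℝ) = √(5^2+12^2) by rw [show (5^2+12^2:ℝ) = 13^2 by norm_num]; simp]
      rw [Complex.norm_def, Complex.normSq_apply]; norm_num
    · rw [eq_neg_of_add_eq_zero_left h]
      rw [show (13:ℝ) = √(5^2+12^2) by rw [show (5^2+12^2:ℝ) = 13^2 by norm_num]; simp]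
      rw [Complex.norm_def, Complex.normSq_apply]; norm_num
  simp_rw [hw] at h
  rw [Finset.prod_pow_eq_pow_sum, InfinitePlace.sum_mult_eq, hd] at h
  exact_mod_cast h.symm

lemma adjoin_top (hx : hev x = 0) (hd : Module.finrank ℚ K = 6) :
    Algebra.adjoin ℚ {(x:K)} = ⊤ := by
  obtain ⟨pb, hg, -⟩ := xiM_pb (hev_K hx) hd
  rw [← hg]; exact pb.adjoin_gen_eq_top

lemma minpolyZ (hx : hev x = 0) : minpoly ℤ x = hpZ := by
  have h1 : minpoly ℤ (x:K) = minpoly ℤ x :=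
    minpoly.algebraMap_eq (FaithfulSMul.algebraMap_injective (𝓞 K) K) x
  have h2 := minpoly.isIntegrallyClosed_eq_field_fractions' ℚ (RingOfIntegers.isIntegral_coe x)
  rw [minpolyM (hev_K hx), hp_eq, h1] at h2
  exact (map_injective _ (RingHom.injective_int _) h2).symm

lemma norm_x (hx : hev x = 0) : (Algebra.norm ℤ x).natAbs = 1 := by
  have : IsUnit x := by
    refine IsUnit.of_mul_eq_one (-(x^5+2*x^4+3*x^3+4*x^2+4*x+2)) ?_
    unfold hev at hx
    linear_combination -hx
  exact Int.isUnit_iff_natAbs_eq.1 (this.map (Algebra.norm ℤ))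

lemma norm_int (hd : Module.finrank ℚ K = 6) (n : ℤ) :
    Algebra.norm ℤ (n : 𝓞 K) = n ^ 6 := by
  have := Algebra.norm_algebraMap (S := 𝓞 K) n
  rw [RingOfIntegers.rank, hd] at this
  simpa using this

lemma discr_bound (hx : hev x = 0) (hd : Module.finrank ℚ K = 6) :
    |discr K| ≤ 10816 := by
  have h1 := aeval_derivative_mem_differentIdeal ℤ ℚ K x (adjoin_top hx hd)
  rw [minpolyZ hx] at h1
  have h2 : aeval x (derivative hpZ) = 2 * x * (1 - imP x * (3*x^2+2*x+1)) := by
    have : derivative hpZ = 6 * X^5 + 10 * X^4 + 12 * X^3 + 12 * X^2 + 8 * X + 2 := by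
      unfold hpZ
      simp
      ring_nf
    rw [this]
    simp only [map_add, map_mul, map_pow, map_ofNat, aeval_X]
    unfold hev at hx; unfold imP
    linear_combination (2+4*x+6*x^2)*hx
  rw [h2] at h1
  have h3 := Ideal.absNorm_dvd_absNorm_of_le ((Ideal.span_singleton_le_iff_mem _).2 h1)
  rw [absNorm_differentIdeal K, Ideal.absNorm_span_singleton, map_mul, map_mul, Int.natAbs_mul,
    Int.natAbs_mul, norm_x hx] at h3
  have h4 : Algebra.norm ℤ (2 : 𝓞 K) = 2 ^ 6 := by simpa using norm_int hd 2
  rw [h4] at h3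
  set e := 1 - imP x * (3*x^2+2*x+1) with he
  have h5 : e^3 * (-3-5*x-3*x^2-3*x^3-2*x^4) = 5 - 12 * imP x := by
    unfold hev at hx
    rw [he]; unfold imP
    linear_combination ((7) + (22)*x^1 + (-36)*x^2 + (367)*x^3 + (2650)*x^4 + (8713)*x^5 + (19637)*x^6 + (34536)*x^7 + (50173)*x^8 + (61919)*x^9 + (65971)*x^10 + (61229)*x^11 + (49677)*x^12 + (35138)*x^13 + (21493)*x^14 + (11209)*x^15 + (4858)*x^16 + (1665)*x^17 + (405)*x^18 + (54)*x^19)*hx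
  have h6 := congrArg (fun t : 𝓞 K => |Algebra.norm ℚ (t:K)|) h5
  have h7 : |Algebra.norm ℚ ((5 - 12 * imP x : 𝓞 K):K)| = 13^6 := by
    rw [← norm_c hx hd]; congr 3
  simp only [h7] at h6
  rw [← Algebra.coe_norm_int, map_mul, map_pow] at h6
  have h8 : |Algebra.norm ℤ e|^3 * |Algebra.norm ℤ (-3-5*x-3*x^2-3*x^3-2*x^4)| = 13^6 := by
    rw [← abs_pow, ← abs_mul]; exact_mod_cast h6
  have h9 : 0 < |Algebra.norm ℤ (-3-5*x-3*x^2-3*x^3-2*x^4)| := by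
    rcases (abs_nonneg (Algebra.norm ℤ (-3-5*x-3*x^2-3*x^3-2*x^4))).eq_or_lt with h | h
    · rw [← h] at h8; norm_num at h8
    · exact h
  have h10 : |Algebra.norm ℤ e| ≤ 169 := by
    by_contra hc
    push Not at hc
    have : (169:ℤ)^3 < |Algebra.norm ℤ e|^3 := by gcongr
    nlinarith
  have h11 : 0 < |Algebra.norm ℤ e| := by
    rcases (abs_nonneg (Algebra.norm ℤ e)).eq_or_lt with h | h
    · rw [← h] at h8; norm_num at h8
    · exact h
  have h12 := Nat.le_of_dvd (by have := Int.natAbs_pos.2 (abs_pos.1 h11); positivity) h3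
  simp only [Int.abs_eq_natAbs] at h10 ⊢
  norm_num at h12
  omega

lemma no_card2 (hx : hev x = 0) (I : Ideal (𝓞 K)) : Nat.card (𝓞 K ⧸ I) ≠ 2 := by
  intro h
  have : Finite (𝓞 K ⧸ I) := Nat.finite_of_card_ne_zero (by omega)
  have := Fintype.ofFinite (𝓞 K ⧸ I)
  rw [Nat.card_eq_fintype_card] at h
  have f := (ZMod.ringEquivOfPrime (𝓞 K ⧸ I) Nat.prime_two h).symm.toRingHom.comp (Ideal.Quotient.mk I)
  have h1 := map_hev f x
  rw [hx, map_zero] at h1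
  have : ∀ y : ZMod 2, (0 : ZMod 2) ≠ hev y := by unfold hev; decide
  exact this _ h1

lemma no_card3 (hx : hev x = 0) (I : Ideal (𝓞 K)) : Nat.card (𝓞 K ⧸ I) ≠ 3 := by
  intro h
  have : Finite (𝓞 K ⧸ I) := Nat.finite_of_card_ne_zero (by omega)
  have := Fintype.ofFinite (𝓞 K ⧸ I)
  rw [Nat.card_eq_fintype_card] at h
  have f := (ZMod.ringEquivOfPrime (𝓞 K ⧸ I) Nat.prime_three h).symm.toRingHom.comp (Ideal.Quotient.mk I)
  have h1 := map_hev f x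
  rw [hx, map_zero] at h1
  have : ∀ y : ZMod 3, (0 : ZMod 3) ≠ hev y := by unfold hev; decide
  exact this _ h1

lemma nrC (hx : hev x = 0) (hd : Module.finrank ℚ K = 6) : InfinitePlace.nrComplexPlaces K = 3 := by
  have := totComplex hx
  have := IsTotallyComplex.finrank K
  omega

lemma pidM (hx : hev x = 0) (hd : Module.finrank ℚ K = 6) : IsPrincipalIdealRing (𝓞 K) := by
  apply RingOfIntegers.isPrincipalIdealRing_of_isPrincipal_of_norm_le_of_isPrime
  intro I hI hle
  exfalso
  rw [nrC hx hd, hd] at hle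
  have hD : √|(discr K : ℝ)| ≤ 104 := by
    rw [Real.sqrt_le_left (by norm_num)]
    have := discr_bound hx hd
    have : (|discr K| : ℝ) ≤ 10816 := by exact_mod_cast this
    linarith
  have hpi : (4 / Real.pi)^3 ≤ (4/3.14)^3 := by
    have := Real.pi_gt_d2
    gcongr
  have h4 : (Ideal.absNorm (I : Ideal (𝓞 K)) : ℝ) < 4 := by
    refine lt_of_le_of_lt hle ?_
    push_cast
    calc _ ≤ (4/3.14 : ℝ)^3 * ((Nat.factorial 6 : ℝ) / 6^6 * 104) := by gcongr
      _ < 4 := by norm_num [Nat.factorial]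
  have h5 : Ideal.absNorm (I : Ideal (𝓞 K)) < 4 := by exact_mod_cast h4
  have h0 : Ideal.absNorm (I : Ideal (𝓞 K)) ≠ 0 := Ideal.absNorm_ne_zero_of_nonZeroDivisors I
  have h1 : Ideal.absNorm (I : Ideal (𝓞 K)) ≠ 1 := by
    rw [Ne, Ideal.absNorm_eq_one_iff]; exact hI.ne_top
  have h2 := no_card2 hx (I : Ideal (𝓞 K))
  have h3 := no_card3 hx (I : Ideal (𝓞 K))
  rw [Ideal.absNorm_apply, Submodule.cardQuot_apply] at *
  omega

end

end PNF2

section PNF3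
open Polynomial NumberField
set_option linter.unusedSectionVars false

lemma lin3 {F : Type*} [Field F] (h2 : (2:F) = 0) {y : F} (hy : y^3+y^2+1 = 0) (a0 a1 a2 : ℤ)
    (h : (a0:F) + a1 * y + a2 * y^2 = 0) : 2 ∣ a0 ∧ 2 ∣ a1 ∧ 2 ∣ a2 := by
  have hp : ∀ a : ℤ, ((2 ∣ a) ∧ (a:F) = 0) ∨ (¬ (2 ∣ a) ∧ (a:F) = 1) := by
    intro a
    rcases Int.even_or_odd' a with ⟨k, rfl | rfl⟩
    · left; exact ⟨⟨k, rfl⟩, by push_cast; rw [h2]; ring⟩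
    · right; exact ⟨by omega, by push_cast; rw [h2]; ring⟩
  have h1 : (1:F) ≠ 0 := one_ne_zero
  rcases hp a0 with ⟨d0, e0⟩ | ⟨d0, e0⟩ <;> rcases hp a1 with ⟨d1, e1⟩ | ⟨d1, e1⟩ <;>
    rcases hp a2 with ⟨d2, e2⟩ | ⟨d2, e2⟩ <;> rw [e0, e1, e2] at h
  · exact ⟨d0, d1, d2⟩
  all_goals exfalso; apply h1; grind

lemma sq_form {Q : Type*} [CommRing Q] (h2 : (2:Q) = 0) {y : Q} (hy : hev y = 0) (c0 c1 c2 c3 c4 c5 : Q) :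
    (c0 + c1*y + c2*y^2+c3*y^3+c4*y^4+c5*y^5)^2 = (c0^2+c3^2+c4^2+c5^2) + (c1^2+c4^2+c5^2)*y^2
      + (c2^2+c3^2+c4^2)*y^4 := by
  have e6 : y^6 = y^4 + 1 := by
    unfold hev at hy
    linear_combination hy - (y^5+2*y^4+2*y^3+2*y^2+y+1) * h2
  have e8 : y^8 = y^4 + y^2 + 1 := by linear_combination (y^2+1)*e6
  have e10 : y^10 = y^2 + 1 := by linear_combination (y^4)*e6 + e8 + y^4 * h2
  linear_combination c3^2*e6 + c4^2*e8 + c5^2*e10 + (c0*c1*y + c0*c2*y^2 + c0*c3*y^3 + c0*c4*y^4 + c0*c5*y^5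
    + c1*c2*y^3 + c1*c3*y^4 + c1*c4*y^5 + c1*c5*y^6 + c2*c3*y^5 + c2*c4*y^6 + c2*c5*y^7 + c3*c4*y^7
    + c3*c5*y^8 + c4*c5*y^9)*h2

section
variable {K : Type} [Field K] [NumberField K] {x : 𝓞 K}

lemma two_not_unit (hd : Module.finrank ℚ K = 6) : Ideal.span {(2 : 𝓞 K)} ≠ ⊤ := by
  intro h
  have h1 := Ideal.absNorm_span_singleton (2 : 𝓞 K)
  have h4 : Algebra.norm ℤ (2 : 𝓞 K) = 2 ^ 6 := by simpa using norm_int hd 2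
  rw [h, h4] at h1
  simp at h1

lemma inj2 (hx : hev x = 0) (hd : Module.finrank ℚ K = 6) (c0 c1 c2 c3 c4 c5 : ℤ)
    (h : (2 : 𝓞 K) ∣ (c0 + c1*x + c2*x^2+c3*x^3+c4*x^4+c5*x^5)) :
    2 ∣ c0 ∧ 2 ∣ c1 ∧ 2 ∣ c2 ∧ 2 ∣ c3 ∧ 2 ∣ c4 ∧ 2 ∣ c5 := by
  obtain ⟨q, hq, hq2⟩ := Ideal.exists_le_maximal _ (two_not_unit hd)
  let _ := Ideal.Quotient.field q
  set f := Ideal.Quotient.mk q with hf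
  have h2 : (2 : 𝓞 K ⧸ q) = 0 := by
    have : f 2 = 0 := by
      rw [hf, Ideal.Quotient.eq_zero_iff_mem]
      exact hq2 (Ideal.mem_span_singleton_self _)
    rwa [map_ofNat] at this
  have hy : hev (f x) = 0 := by rw [← map_hev, hx, map_zero]
  have hg : (f x)^3 + (f x)^2 + 1 = 0 := by
    have : ((f x)^3 + (f x)^2 + 1)^2 = 0 := by
      unfold hev at hy
      linear_combination hy - ((f x)^4+(f x)^3+(f x)^2+f x)*h2
    exact pow_eq_zero_iff (two_ne_zero) |>.1 this
  obtain ⟨z, hz⟩ := h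
  have k1 : ((c0 - (c3-c4+c5) : ℤ) : 𝓞 K ⧸ q) + ((c1-(c4-c5) : ℤ) : 𝓞 K ⧸ q) * f x + ((c2 - c5 - (c3-c4+c5) : ℤ) : 𝓞 K ⧸ q) * (f x)^2 = 0 := by
    have := congrArg f hz
    simp only [map_add, map_mul, map_pow, map_intCast, map_ofNat] at this
    push_cast
    linear_combination this + f z * h2 - (c5 * (f x)^2 + (c4-c5)*(f x) + (c3-c4+c5))*hg
  obtain ⟨⟨a0, p0⟩, ⟨a1, p1⟩, ⟨a2, p2⟩⟩ := lin3 h2 hg _ _ _ k1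
  have k2 : imP x * x^2 * (c5*x^2 + (c4-c5)*x + (c3-c4+c5)) = (x^3+x^2+1) * (z - a0 - a1 * x - a2 * x^2) := by
    have t : (2 : 𝓞 K) ≠ 0 := two_ne_zero
    apply mul_left_cancel₀ t
    have hgi : (x^3+x^2+1)^2 = 2 * imP x * x^2 := by
      unfold hev at hx; unfold imP
      linear_combination (1 - 2*x) * hx
    have p0' := congrArg (Int.cast : ℤ → 𝓞 K) p0
    have p1' := congrArg (Int.cast : ℤ → 𝓞 K) p1
    have p2' := congrArg (Int.cast : ℤ → 𝓞 K) p2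
    push_cast at p0' p1' p2'
    linear_combination (-(c5*x^2 + (c4-c5)*x + (c3-c4+c5)))*hgi + (x^3+x^2+1)*(hz - p0' - x * p1' - x^2 * p2')
  have k3 : (((c3-c4+c5) : ℤ) : 𝓞 K ⧸ q) + ((c4-c5 : ℤ) : 𝓞 K ⧸ q) * f x + ((c5 : ℤ) : 𝓞 K ⧸ q) * (f x)^2 = 0 := by
    have := congrArg f k2
    rw [map_mul, map_mul, map_mul, map_imP] at this
    simp only [map_add, map_mul, map_pow, map_intCast, map_sub, map_one] at this
    rw [hg, zero_mul] at this
    have i0 := imP_sq hy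
    have i1 : imP (f x) ≠ 0 := by intro h; rw [h] at i0; simp at i0
    have i2 : f x ≠ 0 := by intro h; rw [h] at hg; simp at hg
    have := (mul_eq_zero.1 this).resolve_left (mul_ne_zero i1 (pow_ne_zero _ i2))
    push_cast
    linear_combination this
  have := lin3 h2 hg _ _ _ k3
  omega

lemma surj2 (hx : hev x = 0) (hd : Module.finrank ℚ K = 6) (z : 𝓞 K) :
    ∃ c0 c1 c2 c3 c4 c5 : ℤ, (2 : 𝓞 K) ∣ z - (c0 + c1*x + c2*x^2+c3*x^3+c4*x^4+c5*x^5) := by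
  set I := Ideal.span {(2 : 𝓞 K)} with hI
  have hcard : Nat.card (𝓞 K ⧸ I) = 64 := by
    have h1 := Ideal.absNorm_span_singleton (2 : 𝓞 K)
    have h4 : Algebra.norm ℤ (2 : 𝓞 K) = 2 ^ 6 := by simpa using norm_int hd 2
    rw [h4, Ideal.absNorm_apply, Submodule.cardQuot_apply] at h1
    simpa using h1
  let P : (Fin 6 → Fin 2) → 𝓞 K := fun c => ((c 0 : ℕ) : ℤ) + ((c 1 : ℕ) : ℤ) *x + ((c 2 : ℕ) : ℤ)*x^2+((c 3 : ℕ) : ℤ)*x^3+((c 4 : ℕ) : ℤ)*x^4+((c 5 : ℕ) : ℤ)*x^5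
  have hinj : Function.Injective (fun c => Ideal.Quotient.mk I (P c)) := by
    intro c c' h
    have h1 : (2 : 𝓞 K) ∣ P c - P c' := by
      rw [← Ideal.mem_span_singleton, ← hI]
      exact (Ideal.Quotient.eq).1 h
    have := inj2 hx hd (((c 0 : ℕ) : ℤ) - ((c' 0 : ℕ) : ℤ)) (((c 1 : ℕ) : ℤ) - ((c' 1 : ℕ) : ℤ))
      (((c 2 : ℕ) : ℤ) - ((c' 2 : ℕ) : ℤ)) (((c 3 : ℕ) : ℤ) - ((c' 3 : ℕ) : ℤ))
      (((c 4 : ℕ) : ℤ) - ((c' 4 : ℕ) : ℤ)) (((c 5 : ℕ) : ℤ) - ((c' 5 : ℕ) : ℤ)) (by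
        convert h1 using 1
        simp only [P]; push_cast; ring)
    ext i
    fin_cases i <;> simp <;> omega
  have : Finite (𝓞 K ⧸ I) := Nat.finite_of_card_ne_zero (by omega)
  have hb := hinj.bijective_of_nat_card_le (by rw [hcard]; simp)
  obtain ⟨c, hc⟩ := hb.2 (Ideal.Quotient.mk I z)
  refine ⟨((c 0 : ℕ) : ℤ), ((c 1 : ℕ) : ℤ), ((c 2 : ℕ) : ℤ), ((c 3 : ℕ) : ℤ), ((c 4 : ℕ) : ℤ),
    ((c 5 : ℕ) : ℤ), ?_⟩
  · rw [← Ideal.mem_span_singleton, ← hI]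
    exact (Ideal.Quotient.eq).1 hc.symm

lemma sq2 (hx : hev x = 0) (hd : Module.finrank ℚ K = 6) (z : 𝓞 K) :
    ∃ s0 s1 s2 : ℤ, (2 : 𝓞 K) ∣ (s0 + s1*x^2+s2*x^4) - z^2 := by
  obtain ⟨c0, c1, c2, c3, c4, c5, h⟩ := surj2 hx hd z
  refine ⟨(c0^2+c3^2+c4^2+c5^2), (c1^2+c4^2+c5^2), (c2^2+c3^2+c4^2), ?_⟩
  rw [← Ideal.mem_span_singleton] at h ⊢
  set I := Ideal.span {(2 : 𝓞 K)} with hI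
  have h' := (Ideal.Quotient.eq).2 h
  rw [← Ideal.Quotient.eq]
  have h2 : (2 : 𝓞 K ⧸ I) = 0 := by
    have : Ideal.Quotient.mk I 2 = 0 := by
      rw [Ideal.Quotient.eq_zero_iff_mem]
      exact (Ideal.mem_span_singleton_self _)
    rwa [map_ofNat] at this
  have hy : hev (Ideal.Quotient.mk I x) = 0 := by rw [← map_hev, hx, map_zero]
  have := sq_form h2 hy c0 c1 c2 c3 c4 c5
  rw [map_pow, h']
  simp only [map_add, map_mul, map_pow, map_intCast]
  rw [this]
  push_cast
  rfl
end

end PNF3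

section PNF4
open Polynomial NumberField
set_option linter.unusedSectionVars false
set_option linter.unusedSimpArgs false

def xiU {R : Type*} [CommRing R] (x : R) : R := x+2*x^2+x^3+x^4+x^5

lemma xiU_sq {R : Type*} [CommRing R] {x : R} (hx : hev x = 0) : xiU x ^ 2 = 1 + x^2 := by
  unfold xiU; unfold hev at hx
  linear_combination (-1+2*x+x^4)*hx

lemma one_x_inv {R : Type*} [CommRing R] {x : R} (hx : hev x = 0) : (1+x)*(1+x^2) = - (imP x * x) := by
  unfold imP; unfold hev at hx
  linear_combination (1)*hx

section
variable {K : Type} [Field K] [NumberField K] {x : 𝓞 K}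

lemma unit_x {R : Type*} [CommRing R] {x : R} (hx : hev x = 0) : IsUnit x := by
  apply IsUnit.of_mul_eq_one (-(x^5+2*x^4+3*x^3+4*x^2+4*x+2))
  unfold hev at hx
  linear_combination (-1)*hx

lemma unit_imP {R : Type*} [CommRing R] {x : R} (hx : hev x = 0) : IsUnit (imP x) := by
  apply IsUnit.of_mul_eq_one (-imP x)
  linear_combination (-1)*imP_sq hx

lemma unit_both {R : Type*} [CommRing R] {x : R} (hx : hev x = 0) : IsUnit (1+x) ∧ IsUnit (1+x^2) := by
  have : IsUnit ((1+x)*(1+x^2)) := by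
    rw [one_x_inv hx]
    exact ((unit_imP hx).mul (unit_x hx)).neg
  exact IsUnit.mul_iff.1 this

lemma unit_xiU {R : Type*} [CommRing R] {x : R} (hx : hev x = 0) : IsUnit (xiU x) := by
  have := (unit_both hx).2
  rw [← xiU_sq hx] at this
  exact (isUnit_pow_iff two_ne_zero).1 this

lemma odd_even (hx : hev x = 0) (hd : Module.finrank ℚ K = 6) (c0 c1 c2 c3 c4 c5 : ℤ) (z : 𝓞 K)
    (h : c0 + c1*x + c2*x^2+c3*x^3+c4*x^4+c5*x^5 = z^2) : 2 ∣ c1 ∧ 2 ∣ c3 ∧ 2 ∣ c5 := by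
  obtain ⟨s0, s1, s2, hs⟩ := sq2 hx hd z
  have := inj2 hx hd (s0-c0) (-c1) (s1-c2) (-c3) (s2-c4) (-c5) (by
    rw [← h] at hs
    convert hs using 1
    push_cast; ring)
  omega

lemma nosq (hx : hev x = 0) (hd : Module.finrank ℚ K = 6) (a b c : Fin 2) (hne : ¬ (a = 0 ∧ b = 0 ∧ c = 0))
    (u0 u1 u2 : ℤ) (hu : ¬ (2 ∣ u0 ∧ 2 ∣ u1 ∧ 2 ∣ u2)) (z : 𝓞 K)
    (h : x^(a:ℕ) * (1+x)^(b:ℕ) * (xiU x)^(c:ℕ) * (u0 + u1 * x^2 + u2 * x^4) = z^2) : False := by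
  fin_cases a <;> fin_cases b <;> fin_cases c <;> simp at hne <;>
    simp only [Fin.mk_one, Fin.zero_eta, Fin.isValue, Fin.val_zero, Fin.val_one, pow_zero, pow_one, one_mul] at h
  · have := odd_even hx hd ((0)*u0+(1)*u1+(-1)*u2) ((1)*u0+(1)*u1+(-2)*u2) ((2)*u0+(2)*u1+(-3)*u2) ((1)*u0+(1)*u1+(-3)*u2) ((1)*u0+(1)*u1+(-1)*u2) ((1)*u0+(0)*u1+(-1)*u2) z (by 
        rw [← h]
        try unfold xiU
        unfold hev at hx
        push_cast
        linear_combination (-(u0*(0)+u1*((-1)*x^0+(1)*x^1)+u2*((1)*x^0+(-1)*x^2+(1)*x^3)))*hx)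
    omega
  · have := odd_even hx hd ((1)*u0+(0)*u1+(0)*u2) ((1)*u0+(0)*u1+(0)*u2) ((0)*u0+(1)*u1+(0)*u2) ((0)*u0+(1)*u1+(0)*u2) ((0)*u0+(0)*u1+(1)*u2) ((0)*u0+(0)*u1+(1)*u2) z (by 
        rw [← h]
        try unfold xiU
        unfold hev at hx
        push_cast
        linear_combination (-(u0*(0)+u1*(0)+u2*(0)))*hx)
    omega
  · have := odd_even hx hd ((-1)*u0+(1)*u1+(0)*u2) ((-1)*u0+(2)*u1+(-1)*u2) ((-1)*u0+(3)*u1+(-1)*u2) ((-1)*u0+(3)*u1+(-2)*u2) ((-1)*u0+(2)*u1+(-1)*u2) ((0)*u0+(1)*u1+(0)*u2) z (by 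
        rw [← h]
        try unfold xiU
        unfold hev at hx
        push_cast
        linear_combination (-(u0*((1)*x^0)+u1*((-1)*x^0+(1)*x^2)+u2*((1)*x^1+(-1)*x^2+(1)*x^4)))*hx)
    omega
  · have := odd_even hx hd ((0)*u0+(0)*u1+(0)*u2) ((1)*u0+(0)*u1+(0)*u2) ((0)*u0+(0)*u1+(0)*u2) ((0)*u0+(1)*u1+(0)*u2) ((0)*u0+(0)*u1+(0)*u2) ((0)*u0+(0)*u1+(1)*u2) z (by 
        rw [← h]
        try unfold xiU
        unfold hev at hx
        push_cast
        linear_combination (-(u0*(0)+u1*(0)+u2*(0)))*hx)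
    omega
  · have := odd_even hx hd ((-1)*u0+(0)*u1+(1)*u2) ((-2)*u0+(1)*u1+(1)*u2) ((-3)*u0+(1)*u1+(2)*u2) ((-2)*u0+(2)*u1+(1)*u2) ((-2)*u0+(1)*u1+(0)*u2) ((-1)*u0+(1)*u1+(1)*u2) z (by 
        rw [← h]
        try unfold xiU
        unfold hev at hx
        push_cast
        linear_combination (-(u0*((1)*x^0)+u1*((-1)*x^1+(1)*x^2)+u2*((-1)*x^0+(1)*x^1+(-1)*x^3+(1)*x^4)))*hx)
    omega
  · have := odd_even hx hd ((0)*u0+(0)*u1+(-1)*u2) ((1)*u0+(0)*u1+(-2)*u2) ((1)*u0+(0)*u1+(-4)*u2) ((0)*u0+(1)*u1+(-4)*u2) ((0)*u0+(1)*u1+(-3)*u2) ((0)*u0+(0)*u1+(-1)*u2) z (by 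
        rw [← h]
        try unfold xiU
        unfold hev at hx
        push_cast
        linear_combination (-(u0*(0)+u1*(0)+u2*((1)*x^0)))*hx)
    omega
  · have := odd_even hx hd ((0)*u0+(-1)*u1+(0)*u2) ((-1)*u0+(-1)*u1+(0)*u2) ((-1)*u0+(-2)*u1+(-1)*u2) ((-1)*u0+(-1)*u1+(-1)*u2) ((-1)*u0+(0)*u1+(-2)*u2) ((-1)*u0+(0)*u1+(-1)*u2) z (by 
        rw [← h]
        try unfold xiU
        unfold hev at hx
        push_cast
        linear_combination (-(u0*((1)*x^1)+u1*((1)*x^0+(-1)*x^1+(1)*x^3)+u2*((1)*x^2+(-1)*x^3+(1)*x^5)))*hx)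
    omega

lemma parity (hx : hev x = 0) (hd : Module.finrank ℚ K = 6) :
    ∃ par : (𝓞 K)ˣ → Fin 3 → ZMod 2, ∀ u v, par u = par v → ∃ w : (𝓞 K)ˣ, u = v * w^2 := by
  classical
  have hr : Units.rank K = 2 := by
    unfold Units.rank
    have h1 := InfinitePlace.card_eq_nrRealPlaces_add_nrComplexPlaces K
    have := totComplex hx
    rw [nrC hx hd, IsTotallyComplex.nrRealPlaces_eq_zero K] at h1
    omega
  obtain ⟨g, hg⟩ := IsCyclic.exists_generator (α := Units.torsion K)
  have key : ∀ u : (𝓞 K)ˣ, ∃ (k : ℤ) (f : Fin (Units.rank K) → ℤ),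
      u = ((g ^ k : Units.torsion K) : (𝓞 K)ˣ) * ∏ i, (Units.fundSystem K i) ^ (f i) := by
    intro u
    obtain ⟨⟨t, f⟩, h, -⟩ := Units.exist_unique_eq_mul_prod K u
    obtain ⟨k, hk⟩ := Subgroup.mem_zpowers_iff.1 (hg t)
    exact ⟨k, f, by rw [hk]; exact h⟩
  choose k f hkf using key
  refine ⟨fun u => ![(k u : ZMod 2), (f u (Fin.cast hr.symm 0) : ZMod 2), (f u (Fin.cast hr.symm 1) : ZMod 2)], ?_⟩
  intro u v huv
  have e0 := congrFun huv 0
  have e1 := congrFun huv 1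
  have e2 := congrFun huv 2
  simp at e0 e1 e2
  rw [ZMod.intCast_eq_intCast_iff] at e0 e1 e2
  have d0 : ∃ l, k u = k v + 2 * l := by
    obtain ⟨l, hl⟩ := e0.symm.dvd; exact ⟨l, by push_cast at hl; omega⟩
  obtain ⟨l, hl⟩ := d0
  have d1 : ∀ i, ∃ m, f u i = f v i + 2 * m := by
    intro i
    have hi : i = Fin.cast hr.symm 0 ∨ i = Fin.cast hr.symm 1 := by
      rcases i with ⟨i, hi⟩
      simp [Fin.ext_iff]
      omega
    rcases hi with rfl | rfl
    · obtain ⟨l, hl⟩ := e1.symm.dvd; exact ⟨l, by push_cast at hl; omega⟩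
    · obtain ⟨l, hl⟩ := e2.symm.dvd; exact ⟨l, by push_cast at hl; omega⟩
  choose m hm using d1
  refine ⟨((g ^ l : Units.torsion K) : (𝓞 K)ˣ) * ∏ i, (Units.fundSystem K i) ^ (m i), ?_⟩
  rw [hkf u, hkf v, hl]
  have a1 : ∀ (G : Type) [CommGroup G] (g : G) (a b : ℤ), g^(a+2*b) = g^a * (g^b)^2 := by
    intro G _ g a b
    rw [zpow_add, mul_comm 2 b, zpow_mul]; norm_cast
  simp only [hm, a1, Finset.prod_mul_distrib, Finset.prod_pow, Subgroup.coe_mul, Subgroup.coe_pow, mul_pow]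
  exact mul_mul_mul_comm _ _ _ _

lemma bit_diff {G : Type*} [CommGroup G] (g : G) (e e' : Fin 2) :
    ∃ s : G, g^(e:ℕ) = g^(e':ℕ) * g^(((if e = e' then 0 else 1 : Fin 2)):ℕ) * s^2 := by
  by_cases h : e = e'
  · exact ⟨1, by simp [h]⟩
  · have : (e = 0 ∧ e' = 1) ∨ (e = 1 ∧ e' = 0) := by omega
    rcases this with ⟨rfl, rfl⟩ | ⟨rfl, rfl⟩
    · exact ⟨g⁻¹, by simp; group⟩
    · exact ⟨1, by simp⟩

lemma sqrel (hx : hev x = 0) (hd : Module.finrank ℚ K = 6) (U : Fin 4 → (𝓞 K)ˣ) :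
    ∃ d : Fin 4 → Fin 2, d ≠ 0 ∧ ∃ w : (𝓞 K)ˣ, ∏ i, U i ^ (d i : ℕ) = w^2 := by
  obtain ⟨par, hpar⟩ := parity hx hd
  obtain ⟨e, e', hne, he⟩ := Fintype.exists_ne_map_eq_of_card_lt
    (fun e : Fin 4 → Fin 2 => par (∏ i, U i ^ (e i : ℕ))) (by simp [ZMod.card])
  obtain ⟨w, hw⟩ := hpar _ _ he
  choose s hs using fun i => bit_diff (U i) (e i) (e' i)
  refine ⟨fun i => if e i = e' i then 0 else 1, ?_, w * (∏ i, s i)⁻¹, ?_⟩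
  · intro h
    apply hne
    ext i
    have := congrFun h i
    simp at this
    rw [this]
  · simp only [hs, Finset.prod_mul_distrib, Finset.prod_pow] at hw
    rw [mul_assoc] at hw
    have := mul_left_cancel hw
    rw [mul_pow, ← this]
    simp

lemma unit_sq (hx : hev x = 0) (hd : Module.finrank ℚ K = 6) (u0 u1 u2 : ℤ)
    (hu : ¬ (2 ∣ u0 ∧ 2 ∣ u1 ∧ 2 ∣ u2)) (u : (𝓞 K)ˣ) (α : 𝓞 K)
    (h : u0 + u1 * x^2 + u2 * x^4 = u * α^2) : ∃ β : 𝓞 K, u0 + u1 * x^2 + u2 * x^4 = β^2 := by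
  obtain ⟨v0, h0⟩ := unit_x hx
  obtain ⟨v1, h1⟩ := (unit_both hx).1
  obtain ⟨v2, h2⟩ := unit_xiU hx
  obtain ⟨d, hd0, w, hw⟩ := sqrel hx hd ![v0, v1, v2, u]
  have hw' := congrArg (Units.val) hw
  simp [Fin.prod_univ_four] at hw'
  rw [h0, h1, h2] at hw'
  by_cases hb : d 0 = 0 ∧ d 1 = 0 ∧ d 2 = 0
  · obtain ⟨b0, b1, b2⟩ := hb
    have b3 : d 3 = 1 := by
      by_contra hc
      apply hd0
      ext i
      fin_cases i <;> simp [b0, b1, b2]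
      omega
    rw [b0, b1, b2, b3] at hw'
    simp at hw'
    exact ⟨w * α, by rw [h, hw', mul_pow]⟩
  · exfalso
    rcases (show d 3 = 0 ∨ d 3 = 1 by omega) with b3 | b3
    · rw [b3] at hw'
      exact nosq hx hd (d 0) (d 1) (d 2) hb 1 0 0 (by decide) w (by rw [← hw']; simp)
    · rw [b3] at hw'
      refine nosq hx hd (d 0) (d 1) (d 2) hb u0 u1 u2 hu (w*α) ?_
      rw [h, mul_pow, ← hw']
      simp
      ring
end

end PNF4

section PNF5
open Polynomial NumberField
set_option linter.unusedSectionVars false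
set_option linter.unusedSimpArgs false

lemma n_theta {R : Type*} [CommRing R] {x : R} (hx : hev x = 0) :
    (x^2)^3+(x^2)^2-2*x^2-1 = -2*imP x*(x^2*(x^2+1)) := by
  unfold imP; unfold hev at hx
  linear_combination (-1+2*x+2*x^3)*hx

lemma intcast_dvd {R : Type*} [CommRing R] [Nontrivial R] {p : ℕ} (hp : p.Prime) (h0 : (p:R) = 0) (a : ℤ)
    (ha : (a:R) = 0) : (p:ℤ) ∣ a := by
  by_contra hc
  have := (Nat.prime_iff_prime_int.1 hp).coprime_iff_not_dvd.2 hc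
  obtain ⟨r, s, h⟩ := this
  have := congrArg (Int.cast : ℤ → R) h
  push_cast at this
  rw [h0, ha] at this
  simp at this

/-- a common zero in a domain forces an odd prime dividing `m` -/
lemma kappa_prime {κ : Type*} [CommRing κ] [IsDomain κ] {y : κ} (hy : hev y = 0)
    {u0 u1 u2 v0 v1 v2 v3 m w0 w1 w2 w3 w4 : ℤ} (h : QRel u0 u1 u2 v0 v1 v2 v3 m w0 w1 w2 w3 w4)
    (hm : m ≠ 0)
    (hU : (u0:κ) + u1 * y^2 + u2 * (y^2)^2 = 0)
    (hV : (v0:κ) + v1 * y^2 + v2 * (y^2)^2 + v3 * (y^2)^3 = imP y * m * (y^2*(y^2+1)))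
    (hW : (w0:κ) + w1 * y^2 + w2 * (y^2)^2 + w3 * (y^2)^3 + w4 * (y^2)^4 = 0) :
    ∃ p : ℕ, p.Prime ∧ (p:κ) = 0 ∧ (p:ℤ) ∣ m := by
  have hk := h.map (Int.castRingHom κ)
  simp only [eq_intCast] at hk
  have hD := hk.deriv (y^2)
  have hn := n_theta hy
  have hi := imP_sq hy
  have hud : IsUnit (y^2*(y^2+1)) := by
    have := (unit_both hy).2
    rw [add_comm] at this
    exact ((unit_x hy).pow 2).mul this
  have hui := unit_imP hy
  set i := imP y with hi'
  set t := y^2 with ht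
  have e : (m:κ)*(m:κ)*((i*(t*(t+1)))*(3*t^2+2*t-2+2*i*(2*t+1))) = 0 := by
    linear_combination hD + (v1 + 2*v2*t+3*v3*t^2)*(-2*hV - m*hn) - m*(3*t^2+2*t-2)*hV + (u1+2*u2*t)*hW
      + (w1+2*w2*t+3*w3*t^2+4*w4*t^3)*hU + 2*m^2*(t*(t+1))*(2*t+1)*hi
  have hne : i*(t*(t+1)) ≠ 0 := (hui.mul hud).ne_zero
  have main : (m:κ) = 0 ∨ (3*t^2+2*t-2+2*i*(2*t+1)) = 0 := by
    rcases mul_eq_zero.1 e with h | h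
    · left; exact (mul_self_eq_zero.1 h)
    · right; exact (mul_eq_zero.1 h).resolve_left hne
  rcases main with h0 | hF
  · obtain ⟨p, hp⟩ := CharP.exists κ
    have hpm : (p:ℤ) ∣ m := (CharP.intCast_eq_zero_iff κ p m).1 h0
    rcases CharP.char_is_prime_or_zero κ p with hpp | hpp
    · exact ⟨p, hpp, CharP.cast_eq_zero κ p, hpm⟩
    · subst hpp
      simp at hpm
      exact absurd hpm hm
  · have k1 : (3-2*i)^2 = 0 := by
      linear_combination (-19-22*i + (-18+12*i)*t)*hn + (-5+12*i+(11+10*i)*t+(6-4*i)*t^2)*hF + (-20-12*t^2-24*t-8*t^3)*hi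
    have k1 : 3-2*i = 0 := pow_eq_zero_iff two_ne_zero |>.1 k1
    have h13 : (13:κ) = 0 := by linear_combination (3+2*i)*k1 + 4*hi
    have k8 : i = 8 := by linear_combination (-7)*k1 - (i-1)*h13
    have k3 : (t-3)^2 = 0 := by
      rw [k8] at hF
      linear_combination 9*hF - (2*t^2 + 24*t+9)*h13
    have k3 : t = 3 := by
      have := pow_eq_zero_iff two_ne_zero |>.1 k3
      linear_combination this
    have p13 : Nat.Prime 13 := by norm_num
    have h13' : ((13:ℕ):κ) = 0 := by exact_mod_cast h13
    refine ⟨13, p13, h13', ?_⟩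
    rw [k3] at hU hV hW
    rw [k8] at hV
    have a1 := intcast_dvd p13 h13' (u0+u1*3+u2*3^2) (by push_cast; linear_combination hU)
    have a2 := intcast_dvd p13 h13' (w0+w1*3+w2*3^2+w3*3^3+w4*3^4) (by push_cast; linear_combination hW)
    have a3 := intcast_dvd p13 h13' (2*(v0+v1*3+v2*3^2+v3*3^3)+29*m) (by
      push_cast; linear_combination 2*hV + 17*m*h13)
    have e3 := h.eval 3
    obtain ⟨b1, a1⟩ := a1
    obtain ⟨b2, a2⟩ := a2
    obtain ⟨b3, a3⟩ := a3
    push_cast at a1 a2 a3 ⊢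
    have : (13:ℤ) ∣ 109*m^2 := ⟨b3^2 - 4*b1*b2, by
      have : (13:ℤ)*(109*m^2) = 13*(13*(b3^2-4*b1*b2)) := by
        linear_combination (-4)*e3 + (2*(v0+v1*3+v2*3^2+v3*3^3)+29*m+13*b3)*a3
          - 4*(w0+w1*3+w2*3^2+w3*3^3+w4*3^4)*a1 - 52*b1*a2
      omega⟩
    have q13 : Prime (13:ℤ) := by exact_mod_cast Nat.prime_iff_prime_int.1 p13
    rcases q13.dvd_or_dvd this with h | h
    · norm_num at h
    · exact q13.dvd_of_dvd_pow h

lemma kappa_reduce {κ : Type*} [CommRing κ] [IsDomain κ] {y : κ} (hy : hev y = 0)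
    {u0 u1 u2 v0 v1 v2 v3 m w0 w1 w2 w3 w4 : ℤ} (h : QRel u0 u1 u2 v0 v1 v2 v3 m w0 w1 w2 w3 w4)
    (hm : Odd m) (hu : ∀ p : ℕ, p.Prime → ¬ ((p:ℤ) ∣ u0 ∧ (p:ℤ) ∣ u1 ∧ (p:ℤ) ∣ u2))
    (hU : (u0:κ) + u1 * y^2 + u2 * (y^2)^2 = 0)
    (hV : (v0:κ) + v1 * y^2 + v2 * (y^2)^2 + v3 * (y^2)^3 = imP y * m * (y^2*(y^2+1)))
    (hW : (w0:κ) + w1 * y^2 + w2 * (y^2)^2 + w3 * (y^2)^3 + w4 * (y^2)^4 = 0) :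
    ∃ m' v0 v1 v2 v3 w0 w1 w2 w3 w4 : ℤ, Odd m' ∧ m'.natAbs < m.natAbs ∧
      QRel u0 u1 u2 v0 v1 v2 v3 m' w0 w1 w2 w3 w4 := by
  have hm0 : m ≠ 0 := by rintro rfl; simp at hm
  obtain ⟨p, hp, hpk, m', rfl⟩ := kappa_prime hy h hm0 hU hV hW
  have := Fact.mk hp
  have : CharP κ p := by
    obtain ⟨q, hq⟩ := CharP.exists κ
    have hd : q ∣ p := (CharP.cast_eq_zero_iff κ q p).1 hpk
    rcases (Nat.dvd_prime hp).1 hd with h | h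
    · exact absurd h (CharP.char_ne_one κ q)
    · rwa [h] at hq
  let φ : ZMod p →+* κ := ZMod.castHom (dvd_refl p) κ
  have hφ : ∀ a : ℤ, φ (a : ZMod p) = a := fun a => map_intCast φ a
  have hz := h.map (Int.castRingHom (ZMod p))
  simp only [eq_intCast, Int.cast_mul, Int.cast_natCast, CharP.cast_eq_zero, zero_mul] at hz
  obtain ⟨l0, l1, a3, a2, a1, a0⟩ := divU φ (y^2) hz (by simp only [zm_dvd]; exact hu p hp)
    (by simp only [hφ]; exact hU) (by simp only [hφ]; rw [hV]; push_cast; rw [hpk]; ring)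
    (by simp only [hφ]; exact hW)
  obtain ⟨l0, rfl⟩ := ZMod.intCast_surjective l0
  obtain ⟨l1, rfl⟩ := ZMod.intCast_surjective l1
  obtain ⟨v0, v1, v2, v3, w0, w1, w2, w3, w4, hr⟩ := reduce_step hp h (hu p hp) l0 l1
    (by rw [← zm_dvd]; push_cast; rw [a3]; ring) (by rw [← zm_dvd]; push_cast; rw [a2]; ring)
    (by rw [← zm_dvd]; push_cast; rw [a1]; ring) (by rw [← zm_dvd]; push_cast; rw [a0]; ring)
  refine ⟨m', v0, v1, v2, v3, w0, w1, w2, w3, w4, (Int.odd_mul.1 hm).2, ?_, hr⟩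
  rw [Int.natAbs_mul, Int.natAbs_natCast]
  have : 0 < m'.natAbs := by
    apply Int.natAbs_pos.2; rintro rfl; simp at hm0
  nlinarith [hp.two_le]

section
variable {K : Type} [Field K] [NumberField K] {x : 𝓞 K}

lemma U_ne (hx : hev x = 0) (u0 u1 u2 : ℤ) (h : (u0 : 𝓞 K) + u1 * x^2 + u2 * x^4 = 0) :
    u0 = 0 ∧ u1 = 0 ∧ u2 = 0 := by
  have hK := hev_K hx
  have := xiM_indep (by unfold hev at hK; exact hK) u0 0 u1 0 u2 0 (by
    have := congrArg (algebraMap (𝓞 K) K) h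
    simp only [map_add, map_mul, map_pow, map_intCast, map_zero] at this
    push_cast
    linear_combination this)
  obtain ⟨a, -, b, -, c, -⟩ := this
  exact ⟨by exact_mod_cast a, by exact_mod_cast b, by exact_mod_cast c⟩

lemma sqU (hx : hev x = 0) (hd : Module.finrank ℚ K = 6) (u0 u1 u2 : ℤ)
    (hu : ∀ p : ℕ, p.Prime → ¬ ((p:ℤ) ∣ u0 ∧ (p:ℤ) ∣ u1 ∧ (p:ℤ) ∣ u2)) :
    ∀ N : ℕ, ∀ m v0 v1 v2 v3 w0 w1 w2 w3 w4 : ℤ, m.natAbs = N → Odd m →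
      QRel u0 u1 u2 v0 v1 v2 v3 m w0 w1 w2 w3 w4 → ∃ β : 𝓞 K, u0 + u1 * x^2 + u2 * x^4 = β^2 := by
  intro N
  induction N using Nat.strong_induction_on with
  | _ N ih =>
  intro m v0 v1 v2 v3 w0 w1 w2 w3 w4 hN hm h
  have := pidM hx hd
  have hO := h.map (Int.castRingHom (𝓞 K))
  simp only [eq_intCast] at hO
  have hev' := hO.eval (x^2)
  have hn := n_theta hx
  have hi := imP_sq hx
  have hY : (u0 + u1 * x^2 + u2 * x^4 : 𝓞 K) * (w0 + w1 * x^2 + w2 * (x^2)^2 + w3 * (x^2)^3 + w4 * (x^2)^4)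
     = (v0 + v1 * x^2 + v2 * (x^2)^2 + v3 * (x^2)^3 - imP x * m * (x^2*(x^2+1)))^2 := by
    linear_combination -hev' + m*(v0 + v1 * x^2 + v2 * (x^2)^2 + v3 * (x^2)^3)*hn - (m*(x^2*(x^2+1)))^2*hi
  by_cases hc : IsCoprime (u0 + u1 * x^2 + u2 * x^4 : 𝓞 K) (w0 + w1 * x^2 + w2 * (x^2)^2 + w3 * (x^2)^3 + w4 * (x^2)^4)
  · obtain ⟨α, hα⟩ := exists_associated_pow_of_mul_eq_pow' hc hY
    obtain ⟨u, hu'⟩ := hα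
    exact unit_sq hx hd u0 u1 u2 (by exact_mod_cast hu 2 Nat.prime_two) u α (by rw [← hu']; ring)
  · have : ∃ π : 𝓞 K, Prime π ∧ π ∣ (u0 + u1 * x^2 + u2 * x^4 : 𝓞 K) ∧ π ∣ (w0 + w1 * x^2 + w2 * (x^2)^2 + w3 * (x^2)^3 + w4 * (x^2)^4) := by
      by_contra hcon
      push Not at hcon
      apply hc
      apply isCoprime_of_prime_dvd
      · rintro ⟨h0, -⟩
        obtain ⟨rfl, rfl, rfl⟩ := U_ne hx u0 u1 u2 h0
        exact hu 2 Nat.prime_two (by simp)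
      · exact hcon
    obtain ⟨π, hπ, hπU, hπW⟩ := this
    have hπY := hπ.dvd_of_dvd_pow (hY ▸ hπU.mul_right _)
    have hpr : (Ideal.span {π}).IsPrime := (Ideal.span_singleton_prime hπ.ne_zero).2 hπ
    set f := Ideal.Quotient.mk (Ideal.span {π}) with hf
    have ker : ∀ a, π ∣ a → f a = 0 := fun a ha => by
      rw [hf, Ideal.Quotient.eq_zero_iff_mem]; exact Ideal.mem_span_singleton.2 ha
    have hy : hev (f x) = 0 := by rw [← map_hev, hx, map_zero]
    have eU := ker _ hπU
    have eW := ker _ hπW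
    have eY := ker _ hπY
    simp only [map_add, map_mul, map_pow, map_intCast, map_sub, map_one, map_imP] at eU eW eY
    obtain ⟨m', v0, v1, v2, v3, w0, w1, w2, w3, w4, ho, hlt, hr⟩ := kappa_reduce hy h hm hu
      (by linear_combination eU) (by linear_combination eY) (by linear_combination eW)
    exact ih _ (hN ▸ hlt) m' v0 v1 v2 v3 w0 w1 w2 w3 w4 rfl ho hr
end

end PNF5

section PNF6
open Polynomial NumberField
set_option linter.unusedSectionVars false
set_option linter.unusedSimpArgs false

def gam (p0 p1 p2 q0 q1 q2 : ℚ) : ℚ := p0*(2*q0-q1+q2)+p1*(-q0+q1-q2)+p2*(q0-q1+2*q2)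

section
variable {K : Type} [Field K] [CharZero K] {t i : K}

lemma lamMul (hi : i^2 = -1) (ht : t^3 = 1+2*t-t^2+i*(-2*t-2*t^2))
    (hind : ∀ p0 p1 p2 q0 q1 q2 : ℚ, (p0:K)+p1*t+p2*t^2+i*(q0+q1*t+q2*t^2) = 0 →
      p0 = 0 ∧ p1 = 0 ∧ p2 = 0 ∧ q0 = 0 ∧ q1 = 0 ∧ q2 = 0)
    (p0 p1 p2 q0 q1 q2 r0 r1 r2 s0 s1 s2 c0 c1 c2 c3 c4 : ℚ)
    (h : ((p0:K)+p1*t+p2*t^2+i*(q0+q1*t+q2*t^2))*((r0:K)+r1*t+r2*t^2+i*(s0+s1*t+s2*t^2))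
      = c0+c1*t+c2*t^2+c3*t^3+c4*t^4) :
    gam p0 p1 p2 s0 s1 s2 + gam r0 r1 r2 q0 q1 q2 = 0 := by
  have ht4 : t^4 = -1-5*t-t^2+i*(-2-2*t+2*t^2) := by
    linear_combination (t -1-2*i)*ht + (4*t+4*t^2)*hi
  -- real quartic part moved right
  obtain ⟨d3, h3⟩ : ∃ d, d = c3 - (p1*r2+p2*r1 - q1*s2-q2*s1) := ⟨_, rfl⟩
  obtain ⟨d4, h4⟩ : ∃ d, d = c4 - (p2*r2 - q2*s2) := ⟨_, rfl⟩
  obtain ⟨e0, g0⟩ : ∃ d, d = p0*s0+r0*q0 := ⟨_, rfl⟩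
  obtain ⟨e1, g1⟩ : ∃ d, d = p0*s1+p1*s0+r0*q1+r1*q0 := ⟨_, rfl⟩
  obtain ⟨e2, g2⟩ : ∃ d, d = p0*s2+p1*s1+p2*s0+r0*q2+r1*q1+r2*q0 := ⟨_, rfl⟩
  obtain ⟨e3, g3⟩ : ∃ d, d = p1*s2+p2*s1+r1*q2+r2*q1 := ⟨_, rfl⟩
  obtain ⟨e4, g4⟩ : ∃ d, d = p2*s2+r2*q2 := ⟨_, rfl⟩
  have key := hind ((p0*r0-q0*s0) - c0 - d3 + d4 + 2*e4)
    ((p0*r1+p1*r0-q0*s1-q1*s0) - c1 - 2*d3 + 5*d4 + 2*e3+2*e4)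
    ((p0*r2+p1*r1+p2*r0-q0*s2-q1*s1-q2*s0) - c2 + d3 + d4 + 2*e3-2*e4)
    (e0+e3-e4+2*d4) (e1+2*e3-5*e4+2*d3+2*d4) (e2-e3-e4+2*d3-2*d4) (by
      have k0 := congrArg (Rat.cast : ℚ → K) g0
      have k1 := congrArg (Rat.cast : ℚ → K) g1
      have k2 := congrArg (Rat.cast : ℚ → K) g2
      have k3 := congrArg (Rat.cast : ℚ → K) g3
      have k4 := congrArg (Rat.cast : ℚ → K) g4
      have l3 := congrArg (Rat.cast : ℚ → K) h3
      have l4 := congrArg (Rat.cast : ℚ → K) h4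
      push_cast at k0 k1 k2 k3 k4 l3 l4 ⊢
      linear_combination h - ((q0+q1*t+q2*t^2)*(s0+s1*t+s2*t^2))*hi
        + d3 * ht + d4 * ht4 - i*(e3*ht+e4*ht4) + (e3*(2*t+2*t^2)+e4*(2+2*t-2*t^2))*hi
        + i*(k0+k1*t+k2*t^2+k3*t^3+k4*t^4) - t^3*l3-t^4*l4)
  obtain ⟨-, -, -, a0, a1, a2⟩ := key
  unfold gam
  subst g0 g1 g2 g3 g4
  linear_combination 2*a0 - a1 + a2

lemma quart_indep (hi : i^2 = -1) (ht : t^3 = 1+2*t-t^2+i*(-2*t-2*t^2))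
    (hind : ∀ p0 p1 p2 q0 q1 q2 : ℚ, (p0:K)+p1*t+p2*t^2+i*(q0+q1*t+q2*t^2) = 0 →
      p0 = 0 ∧ p1 = 0 ∧ p2 = 0 ∧ q0 = 0 ∧ q1 = 0 ∧ q2 = 0) (c0 c1 c2 c3 c4 : ℚ)
    (h : (c0:K)+c1*t+c2*t^2+c3*t^3+c4*t^4 = 0) : c0 = 0 ∧ c1 = 0 ∧ c2 = 0 ∧ c3 = 0 ∧ c4 = 0 := by
  have ht4 : t^4 = -1-5*t-t^2+i*(-2-2*t+2*t^2) := by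
    linear_combination (t -1-2*i)*ht + (4*t+4*t^2)*hi
  have := hind (c0+c3-c4) (c1+2*c3-5*c4) (c2-c3-c4) (-2*c4) (-2*c3-2*c4) (-2*c3+2*c4) (by
    push_cast
    linear_combination h - c3*ht-c4*ht4)
  obtain ⟨a0, a1, a2, a3, a4, a5⟩ := this
  refine ⟨?_, ?_, ?_, ?_, ?_⟩ <;> linarith

/-- three elements with all pairwise products killed by the functional are dependent -/
lemma skew_dep (P Q : Matrix (Fin 3) (Fin 3) ℚ)
    (h : ∀ j k, gam (P j 0) (P j 1) (P j 2) (Q k 0) (Q k 1) (Q k 2)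
      + gam (P k 0) (P k 1) (P k 2) (Q j 0) (Q j 1) (Q j 2) = 0) :
    ∃ v : Fin 3 → ℚ, v ≠ 0 ∧ ((∀ l, v 0 * P 0 l + v 1 * P 1 l + v 2 * P 2 l = 0) ∨
      (∀ l, v 0 * Q 0 l + v 1 * Q 1 l + v 2 * Q 2 l = 0)) := by
  have hdet : P.det * Q.det = 0 := by
    have h00 := h 0 0
    have h11 := h 1 1
    have h22 := h 2 2
    have h01 := h 0 1
    have h02 := h 0 2
    have h12 := h 1 2
    let G : Matrix (Fin 3) (Fin 3) ℚ := !![2,-1,1;-1,1,-1;1,-1,2]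
    have hG : G.det = 1 := by simp [G, Matrix.det_fin_three]; norm_num
    have hM : (P * G * Q.transpose).transpose = -(P * G * Q.transpose) := by
      ext j k
      have := h j k
      simp only [gam] at this
      simp [G, Matrix.mul_apply, Fin.sum_univ_three, Matrix.transpose_apply]
      linear_combination this
    have h1 := congrArg Matrix.det hM
    rw [Matrix.det_transpose, Matrix.det_neg, Matrix.det_mul, Matrix.det_mul, Matrix.det_transpose, hG] at h1
    simp only [Fintype.card_fin, mul_one] at h1
    linarith
  rcases mul_eq_zero.1 hdet with h0 | h0
  · obtain ⟨v, hv, e⟩ := Matrix.exists_vecMul_eq_zero_iff.2 h0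
    refine ⟨v, hv, Or.inl fun l => ?_⟩
    have := congrFun e l
    simpa [Matrix.vecMul, dotProduct, Fin.sum_univ_three] using this
  · obtain ⟨v, hv, e⟩ := Matrix.exists_vecMul_eq_zero_iff.2 h0
    refine ⟨v, hv, Or.inr fun l => ?_⟩
    have := congrFun e l
    simpa [Matrix.vecMul, dotProduct, Fin.sum_univ_three] using this

/-- rational version of the step -/
lemma step_rat (hi : i^2 = -1) (ht : t^3 = 1+2*t-t^2+i*(-2*t-2*t^2))
    (hind : ∀ p0 p1 p2 q0 q1 q2 : ℚ, (p0:K)+p1*t+p2*t^2+i*(q0+q1*t+q2*t^2) = 0 →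
      p0 = 0 ∧ p1 = 0 ∧ p2 = 0 ∧ q0 = 0 ∧ q1 = 0 ∧ q2 = 0)
    (hsp : ∀ z : K, ∃ p0 p1 p2 q0 q1 q2 : ℚ, z = (p0:K)+p1*t+p2*t^2+i*(q0+q1*t+q2*t^2))
    (ν ω : K) (u0 u1 u2 y0 y1 y2 y3 w0 w1 w2 w3 w4 : ℚ)
    (hU : ν^2 = u0+u1*t+u2*t^2) (hY : 2*(ν*ω) = y0+y1*t+y2*t^2+y3*t^3)
    (hW : ω^2 = w0+w1*t+w2*t^2+w3*t^3+w4*t^4) :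
    ∃ a b c B0 B1 B2 e : ℚ, ¬ (a = 0 ∧ b = 0 ∧ c = 0) ∧ (e = 1 ∨ e = -1) ∧
      b^2*u2+c*b*y3+c^2*w4 = e*B2^2 ∧
      b^2*u1+2*a*b*u2+c*(b*y2+a*y3)+c^2*w3 = e*(2*B1*B2) ∧
      b^2*u0+2*a*b*u1+a^2*u2+c*(b*y1+a*y2)+c^2*w2 = e*(B1^2+2*B0*B2) ∧
      2*a*b*u0+a^2*u1+c*(b*y0+a*y1)+c^2*w1 = e*(2*B0*B1) ∧
      a^2*u0+c*a*y0+c^2*w0 = e*B0^2 := by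
  obtain ⟨p0, p1, p2, q0, q1, q2, hν⟩ := hsp ν
  obtain ⟨r0, r1, r2, s0, s1, s2, hν'⟩ := hsp (t*ν)
  obtain ⟨x0, x1, x2, z0, z1, z2, hω⟩ := hsp ω
  have h00 := lamMul hi ht hind p0 p1 p2 q0 q1 q2 p0 p1 p2 q0 q1 q2 u0 u1 u2 0 0
    (by rw [← hν]; push_cast; linear_combination hU)
  have h01 := lamMul hi ht hind p0 p1 p2 q0 q1 q2 r0 r1 r2 s0 s1 s2 0 u0 u1 u2 0
    (by rw [← hν, ← hν']; push_cast; linear_combination t*hU)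
  have h11 := lamMul hi ht hind r0 r1 r2 s0 s1 s2 r0 r1 r2 s0 s1 s2 0 0 u0 u1 u2
    (by rw [← hν']; push_cast; linear_combination t^2*hU)
  have h02 := lamMul hi ht hind p0 p1 p2 q0 q1 q2 x0 x1 x2 z0 z1 z2 (y0/2) (y1/2) (y2/2) (y3/2) 0
    (by rw [← hν, ← hω]; push_cast; linear_combination hY/2)
  have h12 := lamMul hi ht hind r0 r1 r2 s0 s1 s2 x0 x1 x2 z0 z1 z2 0 (y0/2) (y1/2) (y2/2) (y3/2)
    (by rw [← hν', ← hω]; push_cast; linear_combination t*hY/2)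
  have h22 := lamMul hi ht hind x0 x1 x2 z0 z1 z2 x0 x1 x2 z0 z1 z2 w0 w1 w2 w3 w4
    (by rw [← hω]; linear_combination hW)
  obtain ⟨v, hv, hv'⟩ := skew_dep !![p0,p1,p2;r0,r1,r2;x0,x1,x2] !![q0,q1,q2;s0,s1,s2;z0,z1,z2] (by
    intro j k
    fin_cases j <;> fin_cases k <;> simp
    · linear_combination h00/2
    · exact h01
    · exact h02
    · linear_combination h01
    · linear_combination h11/2
    · exact h12
    · linear_combination h02
    · linear_combination h12
    · linear_combination h22/2)
  have fin : ∀ (B0 B1 B2 e : ℚ), ((v 0 + v 1 * t) * ν + v 2 * ω)^2 = e*((B0:K)+B1*t+B2*t^2)^2 → 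
      (v 1)^2*u2+v 2*v 1*y3+(v 2)^2*w4 = e*B2^2 ∧
      (v 1)^2*u1+2*v 0*v 1*u2+v 2*(v 1*y2+v 0*y3)+(v 2)^2*w3 = e*(2*B1*B2) ∧
      (v 1)^2*u0+2*v 0*v 1*u1+(v 0)^2*u2+v 2*(v 1*y1+v 0*y2)+(v 2)^2*w2 = e*(B1^2+2*B0*B2) ∧
      2*v 0*v 1*u0+(v 0)^2*u1+v 2*(v 1*y0+v 0*y1)+(v 2)^2*w1 = e*(2*B0*B1) ∧
      (v 0)^2*u0+v 2*v 0*y0+(v 2)^2*w0 = e*B0^2 := by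
    intro B0 B1 B2 e h
    have := quart_indep hi ht hind ((v 0)^2*u0+v 2*v 0*y0+(v 2)^2*w0 - e*B0^2)
      (2*v 0*v 1*u0+(v 0)^2*u1+v 2*(v 1*y0+v 0*y1)+(v 2)^2*w1 - e*(2*B0*B1))
      ((v 1)^2*u0+2*v 0*v 1*u1+(v 0)^2*u2+v 2*(v 1*y1+v 0*y2)+(v 2)^2*w2 - e*(B1^2+2*B0*B2))
      ((v 1)^2*u1+2*v 0*v 1*u2+v 2*(v 1*y2+v 0*y3)+(v 2)^2*w3 - e*(2*B1*B2))
      ((v 1)^2*u2+v 2*v 1*y3+(v 2)^2*w4 - e*B2^2) (by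
        push_cast
        linear_combination h - (v 0 + v 1 * t)^2*hU - (v 2)*(v 0 + v 1 * t)*hY - (v 2)^2*hW)
    obtain ⟨a0, a1, a2, a3, a4⟩ := this
    refine ⟨?_, ?_, ?_, ?_, ?_⟩ <;> linarith
  have hne : ¬ (v 0 = 0 ∧ v 1 = 0 ∧ v 2 = 0) := by
    rintro ⟨k0, k1, k2⟩
    apply hv
    ext l
    fin_cases l <;> simp [k0, k1, k2]
  have hlin : (v 0 + v 1 * t) * ν + v 2 * ω = (v 0)*((p0:K)+p1*t+p2*t^2+i*(q0+q1*t+q2*t^2))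
     + v 1 * ((r0:K)+r1*t+r2*t^2+i*(s0+s1*t+s2*t^2)) + v 2*((x0:K)+x1*t+x2*t^2+i*(z0+z1*t+z2*t^2)) := by
    rw [← hν, ← hν', ← hω]; ring
  rcases hv' with h | h
  · have l0 := congrArg (Rat.cast : ℚ → K) (h 0)
    have l1 := congrArg (Rat.cast : ℚ → K) (h 1)
    have l2 := congrArg (Rat.cast : ℚ → K) (h 2)
    simp at l0 l1 l2
    refine ⟨v 0, v 1, v 2, v 0*q0+v 1*s0+v 2*z0, v 0*q1+v 1*s1+v 2*z1, v 0*q2+v 1*s2+v 2*z2, -1, hne, Or.inr rfl, fin _ _ _ _ ?_⟩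
    have : (v 0 + v 1 * t) * ν + v 2 * ω = i*((v 0*q0+v 1*s0+v 2*z0) + (v 0*q1+v 1*s1+v 2*z1)*t + (v 0*q2+v 1*s2+v 2*z2)*t^2) := by
      rw [hlin]; linear_combination l0 + l1*t+l2*t^2
    rw [this, mul_pow, hi]; push_cast; ring
  · have l0 := congrArg (Rat.cast : ℚ → K) (h 0)
    have l1 := congrArg (Rat.cast : ℚ → K) (h 1)
    have l2 := congrArg (Rat.cast : ℚ → K) (h 2)
    simp at l0 l1 l2
    refine ⟨v 0, v 1, v 2, v 0*p0+v 1*r0+v 2*x0, v 0*p1+v 1*r1+v 2*x1, v 0*p2+v 1*r2+v 2*x2, 1, hne, Or.inl rfl, fin _ _ _ _ ?_⟩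
    have : (v 0 + v 1 * t) * ν + v 2 * ω = ((v 0*p0+v 1*r0+v 2*x0) + (v 0*p1+v 1*r1+v 2*x1)*t + (v 0*p2+v 1*r2+v 2*x2)*t^2) := by
      rw [hlin]; linear_combination i*(l0 + l1*t+l2*t^2)
    rw [this]; push_cast; ring
end

end PNF6

section PNF7
open Polynomial NumberField
set_option linter.unusedSectionVars false
set_option linter.unusedSimpArgs false
set_option linter.unusedVariables false

lemma prim_scale (a b c : ℚ) (h : ¬ (a = 0 ∧ b = 0 ∧ c = 0)) :
    ∃ (s : ℚ) (a' b' c' : ℤ), s * a = a' ∧ s * b = b' ∧ s * c = c' ∧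
      ∀ p : ℕ, p.Prime → ¬ ((p:ℤ) ∣ a' ∧ (p:ℤ) ∣ b' ∧ (p:ℤ) ∣ c') := by
  obtain ⟨A, hA⟩ : ∃ A : ℤ, A = a.num * b.den * c.den := ⟨_, rfl⟩
  obtain ⟨B, hB⟩ : ∃ A : ℤ, A = a.den * b.num * c.den := ⟨_, rfl⟩
  obtain ⟨C, hC⟩ : ∃ A : ℤ, A = a.den * b.den * c.num := ⟨_, rfl⟩
  obtain ⟨D, hD⟩ : ∃ D : ℚ, D = a.den * b.den * c.den := ⟨_, rfl⟩
  have da : (a.den : ℚ) ≠ 0 := by exact_mod_cast a.den_nz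
  have db : (b.den : ℚ) ≠ 0 := by exact_mod_cast b.den_nz
  have dc : (c.den : ℚ) ≠ 0 := by exact_mod_cast c.den_nz
  have na := a.num_div_den
  have nb := b.num_div_den
  have nc := c.num_div_den
  rw [div_eq_iff da] at na
  rw [div_eq_iff db] at nb
  rw [div_eq_iff dc] at nc
  have eA : D * a = A := by rw [hA, hD]; push_cast; rw [na]; ring
  have eB : D * b = B := by rw [hB, hD]; push_cast; rw [nb]; ring
  have eC : D * c = C := by rw [hC, hD]; push_cast; rw [nc]; ring
  have hD0 : D ≠ 0 := by rw [hD]; positivity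
  have hg : Int.gcd A (Int.gcd B C) ≠ 0 := by
    intro h0
    rw [Int.gcd_eq_zero_iff] at h0
    obtain ⟨h1, h2⟩ := h0
    have h2 : Int.gcd B C = 0 := by exact_mod_cast h2
    rw [Int.gcd_eq_zero_iff] at h2
    apply h
    rw [h1] at eA; rw [h2.1] at eB; rw [h2.2] at eC
    simp [hD0] at eA eB eC
    exact ⟨eA, eB, eC⟩
  obtain ⟨g, hgd⟩ : ∃ g, g = Int.gcd A (Int.gcd B C) := ⟨_, rfl⟩
  rw [← hgd] at hg
  have g1 : (g:ℤ) ∣ A := hgd ▸ Int.gcd_dvd_left _ _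
  have g2 : (g:ℤ) ∣ Int.gcd B C := hgd ▸ Int.gcd_dvd_right _ _
  have g3 : (g:ℤ) ∣ B := g2.trans (Int.gcd_dvd_left _ _)
  have g4 : (g:ℤ) ∣ C := g2.trans (Int.gcd_dvd_right _ _)
  obtain ⟨A', rfl⟩ := g1
  obtain ⟨B', rfl⟩ := g3
  obtain ⟨C', rfl⟩ := g4
  have hgq : (g:ℚ) ≠ 0 := by exact_mod_cast hg
  refine ⟨D/g, A', B', C', ?_, ?_, ?_, ?_⟩
  · rw [div_mul_eq_mul_div, eA]; push_cast; field_simp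
  · rw [div_mul_eq_mul_div, eB]; push_cast; field_simp
  · rw [div_mul_eq_mul_div, eC]; push_cast; field_simp
  · rintro p hp ⟨h1, h2, h3⟩
    have k2 : (g*p : ℤ) ∣ Int.gcd (g*B') (g*C') := Int.dvd_coe_gcd (mul_dvd_mul_left _ h2) (mul_dvd_mul_left _ h3)
    have k1 : (g*p : ℤ) ∣ Int.gcd (g*A') (Int.gcd (g*B') (g*C')) := Int.dvd_coe_gcd (mul_dvd_mul_left _ h1) k2
    rw [← hgd] at k1
    have k1 : g * p ∣ g := by exact_mod_cast k1
    have := Nat.le_of_dvd (Nat.pos_of_ne_zero hg) k1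
    have := hp.two_le
    have : 0 < g := Nat.pos_of_ne_zero hg
    nlinarith

lemma rat_int_of_sq (q : ℚ) (n : ℤ) (h : q^2 = n) : ∃ k : ℤ, q = k := by
  have h1 : IsSquare (n:ℚ) := ⟨q, by rw [← h]; ring⟩
  obtain ⟨k, hk⟩ := Rat.isSquare_intCast_iff.1 h1
  have h2 : q^2 = (k:ℚ)^2 := by rw [h, hk]; push_cast; ring
  rcases sq_eq_sq_iff_eq_or_eq_neg.1 h2 with h3 | h3
  · exact ⟨k, h3⟩
  · exact ⟨-k, by rw [h3]; push_cast; rfl⟩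

/-- integral version of the step -/
lemma step_raw (u0 u1 u2 v0 v1 v2 v3 m w0 w1 w2 w3 w4 : ℤ)
    (hu : ∀ p : ℕ, p.Prime → ¬ ((p:ℤ) ∣ u0 ∧ (p:ℤ) ∣ u1 ∧ (p:ℤ) ∣ u2)) (hm : Odd m)
    (h : QRel u0 u1 u2 v0 v1 v2 v3 m w0 w1 w2 w3 w4) :
    ∃ a b c B0 B1 B2 e : ℤ, (∀ p : ℕ, p.Prime → ¬ ((p:ℤ) ∣ a ∧ (p:ℤ) ∣ b ∧ (p:ℤ) ∣ c)) ∧ (e = 1 ∨ e = -1) ∧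
      b^2*u2+c*b*(2*v3+m)+c^2*w4 = e*B2^2 ∧
      b^2*u1+2*a*b*u2+c*(b*(2*v2+m)+a*(2*v3+m))+c^2*w3 = e*(2*B1*B2) ∧
      b^2*u0+2*a*b*u1+a^2*u2+c*(b*(2*v1-2*m)+a*(2*v2+m))+c^2*w2 = e*(B1^2+2*B0*B2) ∧
      2*a*b*u0+a^2*u1+c*(b*(2*v0-m)+a*(2*v1-2*m))+c^2*w1 = e*(2*B0*B1) ∧
      a^2*u0+c*a*(2*v0-m)+c^2*w0 = e*B0^2 := by
  obtain ⟨K, _, _, ξ, hξ, hd⟩ := exists_fieldM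
  have hK : hev ξ = 0 := by unfold hev; exact hξ
  have hxiInt : IsIntegral ℤ ξ := by
    refine ⟨X^6 + 2*X^5 + 3*X^4 + 4*X^3 + 4*X^2 + 2*X + 1, by monicity!, ?_⟩
    simp only [eval₂_add, eval₂_mul, eval₂_pow, eval₂_X, eval₂_one, eval₂_ofNat]
    exact hξ
  obtain ⟨x, hxξ⟩ : ∃ x : 𝓞 K, (x : K) = ξ := ⟨⟨ξ, hxiInt⟩, rfl⟩
  have hx : hev x = 0 := by
    apply RingOfIntegers.coe_injective
    have := map_hev (algebraMap (𝓞 K) K) x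
    rw [this, map_zero]
    have e : algebraMap (𝓞 K) K x = ξ := hxξ
    rw [e]; exact hK
  obtain ⟨β, hβ⟩ := sqU hx hd u0 u1 u2 hu _ m v0 v1 v2 v3 w0 w1 w2 w3 w4 rfl hm h
  have hi := imP_sq hK
  have hn := n_theta hK
  have e1 : ξ = ξ^2 + imP ξ * (1 - (ξ^2)^2) := by
    unfold imP; linear_combination (-1+ξ^3)*hξ
  have e3 : ξ^3 = -2*ξ^2-(ξ^2)^2 + imP ξ * (-1-ξ^2+(ξ^2)^2) := by
    unfold imP; linear_combination (1+ξ-ξ^3)*hξ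
  have e5 : ξ^5 = -1+(ξ^2)^2 + imP ξ * (1+3*ξ^2) := by
    unfold imP; linear_combination (-3*ξ)*hξ
  have ht : (ξ^2)^3 = 1+2*ξ^2-(ξ^2)^2+imP ξ*(-2*ξ^2-2*(ξ^2)^2) := by linear_combination hn
  have hind : ∀ p0 p1 p2 q0 q1 q2 : ℚ, (p0:K)+p1*ξ^2+p2*(ξ^2)^2+imP ξ*(q0+q1*ξ^2+q2*(ξ^2)^2) = 0 →
      p0 = 0 ∧ p1 = 0 ∧ p2 = 0 ∧ q0 = 0 ∧ q1 = 0 ∧ q2 = 0 := by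
    intro p0 p1 p2 q0 q1 q2 h0
    obtain ⟨a0, a1, a2, a3, a4, a5⟩ := xiM_indep hξ (p0+q0+q2) (3*q0-q1+2*q2) (p1+3*q0-q1+4*q2) (3*q0-q1+3*q2)
      (p2+2*q0-q1+2*q2) (q0+q2) (by
        unfold imP at h0; push_cast
        linear_combination h0 - (q1*ξ+q2*(-1+ξ^3))*hξ)
    refine ⟨?_, ?_, ?_, ?_, ?_, ?_⟩ <;> linarith
  have hsp : ∀ z : K, ∃ p0 p1 p2 q0 q1 q2 : ℚ, z = (p0:K)+p1*ξ^2+p2*(ξ^2)^2+imP ξ*(q0+q1*ξ^2+q2*(ξ^2)^2) := by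
    intro z
    obtain ⟨c0, c1, c2, c3, c4, c5, hc⟩ := xiM_span hξ hd z
    refine ⟨c0-c5, c1+c2-2*c3, -c3+c4+c5, c1-c3+c5, -c3+3*c5, -c1+c3, ?_⟩
    push_cast
    linear_combination hc + c1*e1+c3*e3+c5*e5
  have hU : (β:K)^2 = u0+u1*ξ^2+u2*(ξ^2)^2 := by
    have := congrArg (algebraMap (𝓞 K) K) hβ
    have e : algebraMap (𝓞 K) K x = ξ := hxξ
    simp only [map_add, map_mul, map_pow, map_intCast, e] at this
    have e' : algebraMap (𝓞 K) K β = (β:K) := rfl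
    rw [e'] at this
    linear_combination -this
  have hβ0 : (β:K) ≠ 0 := by
    intro h0
    rw [h0] at hU
    have := hind u0 u1 u2 0 0 0 (by push_cast; linear_combination -hU)
    obtain ⟨a0, a1, a2, -⟩ := this
    apply hu 2 Nat.prime_two
    have a0 : u0 = 0 := by exact_mod_cast a0
    have a1 : u1 = 0 := by exact_mod_cast a1
    have a2 : u2 = 0 := by exact_mod_cast a2
    simp [a0, a1, a2]
  have hk := h.map (Int.castRingHom K)
  simp only [eq_intCast] at hk
  have hE := hk.eval (ξ^2)
  obtain ⟨Y, hYd⟩ : ∃ Y : K, 2*Y = (2*v0-m)+(2*v1-2*m)*ξ^2+(2*v2+m)*(ξ^2)^2+(2*v3+m)*(ξ^2)^3 := ⟨_/2, mul_div_cancel₀ _ two_ne_zero⟩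
  have hY2 : 4*Y^2 = 4*((u0+u1*ξ^2+u2*(ξ^2)^2)*(w0+w1*ξ^2+w2*(ξ^2)^2+w3*(ξ^2)^3+w4*(ξ^2)^4)) := by
    linear_combination 4*hE + (2*Y + ((2*v0-m)+(2*v1-2*m)*ξ^2+(2*v2+m)*(ξ^2)^2+(2*v3+m)*(ξ^2)^3))*hYd
      + m^2*((ξ^2)^3+(ξ^2)^2-2*ξ^2-1 + -2*imP ξ*(ξ^2*(ξ^2+1)))*hn + 4*m^2*(ξ^2*(ξ^2+1))^2*hi
  have hW : (Y/β)^2 = w0+w1*ξ^2+w2*(ξ^2)^2+w3*(ξ^2)^3+w4*(ξ^2)^4 := by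
    rw [div_pow, div_eq_iff (pow_ne_zero 2 hβ0), hU]
    linear_combination hY2/4
  obtain ⟨a, b, c, B0, B1, B2, e, hne, he, f4, f3, f2, f1, f0⟩ := step_rat hi ht hind hsp (β:K) (Y/β)
    u0 u1 u2 (2*v0-m) (2*v1-2*m) (2*v2+m) (2*v3+m) w0 w1 w2 w3 w4 (by push_cast; exact hU)
    (by rw [mul_div_cancel₀ _ hβ0, hYd]; push_cast; ring) (by push_cast; exact hW)
  obtain ⟨s, a', b', c', ea, eb, ec, hp⟩ := prim_scale a b c hne
  have he' : ∃ e' : ℤ, (e = e') ∧ (e' = 1 ∨ e' = -1) := by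
    rcases he with rfl | rfl
    · exact ⟨1, by simp⟩
    · exact ⟨-1, by simp⟩
  obtain ⟨e', rfl, he''⟩ := he'
  have hee : (e':ℚ)*e' = 1 := by rcases he'' with rfl | rfl <;> norm_num
  have g4 : (b':ℚ)^2*u2+c'*b'*(2*v3+m)+c'^2*w4 = e'*(s*B2)^2 := by
    rw [← eb, ← ec]; linear_combination s^2*f4
  have g3 : (b':ℚ)^2*u1+2*a'*b'*u2+c'*(b'*(2*v2+m)+a'*(2*v3+m))+c'^2*w3 = e'*(2*(s*B1)*(s*B2)) := by
    rw [← ea, ← eb, ← ec]; linear_combination s^2*f3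
  have g2 : (b':ℚ)^2*u0+2*a'*b'*u1+a'^2*u2+c'*(b'*(2*v1-2*m)+a'*(2*v2+m))+c'^2*w2 = e'*((s*B1)^2+2*(s*B0)*(s*B2)) := by
    rw [← ea, ← eb, ← ec]; linear_combination s^2*f2
  have g1 : 2*(a':ℚ)*b'*u0+a'^2*u1+c'*(b'*(2*v0-m)+a'*(2*v1-2*m))+c'^2*w1 = e'*(2*(s*B0)*(s*B1)) := by
    rw [← ea, ← eb, ← ec]; linear_combination s^2*f1
  have g0 : (a':ℚ)^2*u0+c'*a'*(2*v0-m)+c'^2*w0 = e'*(s*B0)^2 := by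
    rw [← ea, ← ec]; linear_combination s^2*f0
  obtain ⟨b2, hb2⟩ := rat_int_of_sq (s*B2) (e'*(b'^2*u2+c'*b'*(2*v3+m)+c'^2*w4)) (by
    push_cast; linear_combination (-e')*g4 - (s*B2)^2*hee)
  obtain ⟨b0, hb0⟩ := rat_int_of_sq (s*B0) (e'*(a'^2*u0+c'*a'*(2*v0-m)+c'^2*w0)) (by
    push_cast; linear_combination (-e')*g0 - (s*B0)^2*hee)
  rw [hb2] at g4 g3 g2
  rw [hb0] at g2 g1 g0
  obtain ⟨b1, hb1⟩ := rat_int_of_sq (s*B1) (e'*(b'^2*u0+2*a'*b'*u1+a'^2*u2+c'*(b'*(2*v1-2*m)+a'*(2*v2+m))+c'^2*w2)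
    - 2*b0*b2) (by
    push_cast; linear_combination (-e')*g2 - ((s*B1)^2+2*b0*b2)*hee)
  rw [hb1] at g3 g2 g1
  exact ⟨a', b', c', b0, b1, b2, e', hp, he'', by exact_mod_cast g4, by exact_mod_cast g3, by exact_mod_cast g2,
    by exact_mod_cast g1, by exact_mod_cast g0⟩

end PNF7

section PNF8
set_option linter.unusedVariables false

def Prim3 (u0 u1 u2 : ℤ) : Prop := ∀ p : ℕ, p.Prime → ¬ ((p:ℤ) ∣ u0 ∧ (p:ℤ) ∣ u1 ∧ (p:ℤ) ∣ u2)

lemma QRel.ne_zero_field {F : Type*} [Field F] {u0 u1 u2 v0 v1 v2 v3 m : F}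
    (h : QRel u0 u1 u2 v0 v1 v2 v3 m 0 0 0 0 0) : m = 0 ∧ v0 = 0 ∧ v1 = 0 ∧ v2 = 0 ∧ v3 = 0 := by
  obtain ⟨h6, h5, h4, h3, h2, h1, h0⟩ := h
  simp only [mul_zero, add_zero] at *
  have hm : m = 0 := by
    by_contra hm
    have h6' : v3 * (v3 + m) = 0 := by linear_combination h6
    rcases mul_eq_zero.1 h6' with k | k
    · have k2 : v2 = 0 := by
        apply mul_left_cancel₀ hm; linear_combination h5 - (2*v2+m)*k
      have k1 : v1 = m := by
        apply mul_left_cancel₀ hm; linear_combination h4 - (2*v1-2*m)*k - (v2+m)*k2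
      have k0 : v0 = m := by
        apply mul_left_cancel₀ hm; subst k k2 k1; linear_combination h3
      apply hm
      have : m^2 = 0 := by rw [k2, k0, k1] at h2; linear_combination -h2
      exact pow_eq_zero_iff two_ne_zero |>.1 this
    · have k : v3 = -m := by linear_combination k
      subst k
      have k2 : v2 = -m := by
        apply mul_left_cancel₀ hm; linear_combination -h5
      subst k2
      have k1 : v1 = m := by
        apply mul_left_cancel₀ hm; linear_combination -h4
      subst k1
      have k0 : v0 = 0 := by
        apply mul_left_cancel₀ hm; linear_combination -h3
      subst k0
      apply hm
      have : v1^2 = 0 := by linear_combination -h2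
      exact pow_eq_zero_iff two_ne_zero |>.1 this
  subst hm
  have k3 : v3 = 0 := by
    apply pow_eq_zero_iff two_ne_zero |>.1; linear_combination h6
  subst k3
  have k2 : v2 = 0 := by
    apply pow_eq_zero_iff two_ne_zero |>.1; linear_combination h4
  subst k2
  have k1 : v1 = 0 := by
    apply pow_eq_zero_iff two_ne_zero |>.1; linear_combination h2
  have k0 : v0 = 0 := by
    apply pow_eq_zero_iff two_ne_zero |>.1; linear_combination h0
  simp [k1, k0]

/-- make `B` primitive -/
lemma prim_B (N : ℕ) : ∀ (u0 u1 u2 v0 v1 v2 v3 m b0 b1 b2 e : ℤ), Odd m → m.natAbs ≤ N →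
    QRel u0 u1 u2 v0 v1 v2 v3 m (e*b0^2) (e*(2*b0*b1)) (e*(b1^2+2*b0*b2)) (e*(2*b1*b2)) (e*b2^2) →
    ∃ v0 v1 v2 v3 m b0 b1 b2 : ℤ, Odd m ∧ Prim3 b0 b1 b2 ∧
      QRel u0 u1 u2 v0 v1 v2 v3 m (e*b0^2) (e*(2*b0*b1)) (e*(b1^2+2*b0*b2)) (e*(2*b1*b2)) (e*b2^2) := by
  induction N with
  | zero =>
    intro u0 u1 u2 v0 v1 v2 v3 m b0 b1 b2 e hm hN h
    have : m = 0 := by omega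
    subst this
    simp at hm
  | succ N ih =>
    intro u0 u1 u2 v0 v1 v2 v3 m b0 b1 b2 e hm hN h
    by_cases hp : Prim3 b0 b1 b2
    · exact ⟨v0, v1, v2, v3, m, b0, b1, b2, hm, hp, h⟩
    · unfold Prim3 at hp
      push Not at hp
      obtain ⟨p, hp, k0, k1, k2⟩ := hp
      have := Fact.mk hp
      have h' := h.map (Int.castRingHom (ZMod p))
      rw [← zm_dvd] at k0 k1 k2
      simp only [eq_intCast] at h'
      push_cast at h'
      rw [k0, k1, k2] at h'
      have h'' := QRel.ne_zero_field (by simpa using h')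
      simp only [zm_dvd] at h'' k0 k1 k2
      obtain ⟨⟨m, rfl⟩, ⟨v0, rfl⟩, ⟨v1, rfl⟩, ⟨v2, rfl⟩, ⟨v3, rfl⟩⟩ := h''
      obtain ⟨b0, rfl⟩ := k0
      obtain ⟨b1, rfl⟩ := k1
      obtain ⟨b2, rfl⟩ := k2
      have hpz : (p:ℤ)^2 ≠ 0 := by exact_mod_cast pow_ne_zero 2 hp.ne_zero
      have hm' : Odd m := (Int.odd_mul.1 hm).2
      apply ih u0 u1 u2 v0 v1 v2 v3 m b0 b1 b2 e hm'
      · have h1 := hp.two_le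
        rw [Int.natAbs_mul, Int.natAbs_natCast] at hN
        have : m.natAbs ≠ 0 := by
          intro h0
          have : m = 0 := by omega
          subst this
          simp at hm'
        nlinarith [Nat.pos_of_ne_zero this]
      · obtain ⟨h6, h5, h4, h3, h2, h1, h0⟩ := h
        constructor <;> apply mul_left_cancel₀ hpz
        · linear_combination h6
        · linear_combination h5
        · linear_combination h4
        · linear_combination h3
        · linear_combination h2
        · linear_combination h1
        · linear_combination h0

lemma n_odd (x z : ℤ) (h : ¬ ((2:ℤ) ∣ x ∧ (2:ℤ) ∣ z)) : Odd (x^3+x^2*z-2*x*z^2-z^3) := by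
  rw [← Int.not_even_iff_odd]
  intro hn
  rcases Int.even_or_odd x with hx | hx <;> rcases Int.even_or_odd z with hz | hz
  · exact h ⟨hx.two_dvd, hz.two_dvd⟩
  all_goals
    rw [← Int.not_odd_iff_even] at hn
    apply hn
    first
    | rw [← Int.not_even_iff_odd] at hx
    | skip
    first
    | rw [← Int.not_even_iff_odd] at hz
    | skip
    simp [Int.even_sub, Int.even_add, Int.even_mul, Int.even_pow, ← Int.not_even_iff_odd, hx, hz]

/-- step, with `B` not yet primitive -/
lemma step_pre (u0 u1 u2 v0 v1 v2 v3 m w0 w1 w2 w3 w4 : ℤ) (hu : Prim3 u0 u1 u2) (hm : Odd m)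
    (h : QRel u0 u1 u2 v0 v1 v2 v3 m w0 w1 w2 w3 w4) (a b c B0 B1 B2 e : ℤ) (hab : Prim3 a b c)
    (he : e = 1 ∨ e = -1)
    (s4 : b^2*u2+c*b*(2*v3+m)+c^2*w4 = e*B2^2)
    (s3 : b^2*u1+2*a*b*u2+c*(b*(2*v2+m)+a*(2*v3+m))+c^2*w3 = e*(2*B1*B2))
    (s2 : b^2*u0+2*a*b*u1+a^2*u2+c*(b*(2*v1-2*m)+a*(2*v2+m))+c^2*w2 = e*(B1^2+2*B0*B2))
    (s1 : 2*a*b*u0+a^2*u1+c*(b*(2*v0-m)+a*(2*v1-2*m))+c^2*w1 = e*(2*B0*B1))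
    (s0 : a^2*u0+c*a*(2*v0-m)+c^2*w0 = e*B0^2) :
    ∃ v0 v1 v2 v3 m b0 b1 b2 e : ℤ, Odd m ∧ (e = 1 ∨ e = -1) ∧
      QRel u0 u1 u2 v0 v1 v2 v3 m (e*b0^2) (e*(2*b0*b1)) (e*(b1^2+2*b0*b2)) (e*(2*b1*b2)) (e*b2^2) := by
  rcases Int.even_or_odd c with hc | hc
  · by_cases c0 : c = 0
    · subst c0
      simp only [zero_mul, add_zero, ne_eq, OfNat.ofNat_ne_zero, not_false_eq_true, zero_pow] at s0 s1 s2 s3 s4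
      have hcop : IsCoprime a b := by
        rw [Int.isCoprime_iff_gcd_eq_one]
        by_contra hg
        obtain ⟨p, hp, hpg⟩ := Nat.exists_prime_and_dvd hg
        have : (p:ℤ) ∣ Int.gcd a b := by exact_mod_cast hpg
        exact hab p hp ⟨this.trans (Int.gcd_dvd_left _ _), this.trans (Int.gcd_dvd_right _ _), dvd_zero _⟩
      obtain ⟨p, q, hpq⟩ := hcop
      have hpt : a^2*B2 - a*b*B1 + b^2*B0 = 0 := by
        have he0 : e ≠ 0 := by rcases he with rfl | rfl <;> norm_num
        apply pow_eq_zero_iff two_ne_zero |>.1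
        apply mul_left_cancel₀ he0
        linear_combination -a^4*s4 + a^3*b*s3 - a^2*b^2*s2 + a*b^3*s1 - b^4*s0
      obtain ⟨s, hs⟩ : ∃ s, s = p^2*(a*B1-b*B0)+2*a*p*q*B2+b*q^2*B2 := ⟨_, rfl⟩
      obtain ⟨t, ht⟩ : ∃ t, t = q^2*(b*B1-a*B2)+2*b*p*q*B0+a*p^2*B0 := ⟨_, rfl⟩
      have r2 : B2 = b*s := by
        rw [hs]; linear_combination p^2*hpt - (p*a+q*b+1)*B2*hpq
      have r0 : B0 = a*t := by
        rw [ht]; linear_combination q^2*hpt - (p*a+q*b+1)*B0*hpq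
      have r1 : B1 = b*t+a*s := by
        rw [ht, hs]; linear_combination -2*p*q*hpt - (p*a+q*b+1)*B1*hpq
      clear hs ht
      subst r0 r1 r2
      have hU : u0 = e*t^2 ∧ u1 = e*(2*s*t) ∧ u2 = e*s^2 := by
        by_cases hb : b = 0
        · subst hb
          have ha : a^2 ≠ 0 := by
            intro ha
            have ha := pow_eq_zero_iff two_ne_zero |>.1 ha
            subst ha
            simp at hpq
          refine ⟨?_, ?_, ?_⟩ <;> apply mul_left_cancel₀ ha
          · linear_combination s0
          · linear_combination s1
          · linear_combination s2
        · have hb : b^2 ≠ 0 := pow_ne_zero _ hb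
          have e2 : u2 = e*s^2 := by
            apply mul_left_cancel₀ hb; linear_combination s4
          have e1 : u1 = e*(2*s*t) := by
            apply mul_left_cancel₀ hb; linear_combination s3 - 2*a*b*e2
          refine ⟨?_, e1, e2⟩
          apply mul_left_cancel₀ hb; linear_combination s2 - 2*a*b*e1 - a^2*e2
      obtain ⟨rfl, rfl, rfl⟩ := hU
      clear s0 s1 s2 s3 s4 hpt
      have hn0 : Odd (t^3+t^2*(-s)-2*t*(-s)^2-(-s)^3) := by
        apply n_odd
        rintro ⟨h1, h2⟩
        rw [dvd_neg] at h2
        refine hu 2 Nat.prime_two ⟨?_, ?_, ?_⟩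
        · exact Dvd.dvd.mul_left (dvd_pow h1 two_ne_zero) _
        · exact Dvd.dvd.mul_left (Dvd.dvd.mul_left h1 _) _
        · exact Dvd.dvd.mul_left (dvd_pow h2 two_ne_zero) _
      have hV := h.eval2 t (-s)
      have hz : (e*t^2*(-s)^2 + e*(2*s*t)*t*(-s)+e*s^2*t^2) = 0 := by ring
      rw [hz, zero_mul] at hV
      generalize hV0 : v0 * (-s) ^ 3 + v1 * t * (-s) ^ 2 + v2 * t ^ 2 * -s + v3 * t ^ 3 = V0 at hV
      obtain ⟨n0, hn⟩ : ∃ n0, n0 = t^3+t^2*(-s)-2*t*(-s)^2-(-s)^3 := ⟨_, rfl⟩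
      obtain ⟨d0, hd⟩ : ∃ d0, d0 = t*(-s)*(t+-s) := ⟨_, rfl⟩
      rw [← hn] at hn0
      rw [← hn, ← hd] at hV
      -- V1 = 2 m d0 d - V0 n
      have he2 : e^2 = 1 := by rcases he with rfl | rfl <;> norm_num
      refine ⟨V0, 2*m*d0+2*V0, 2*m*d0-V0, -V0, m*n0+2*V0, m*(-s*(s-t)), m*(3*s*t-t^2-s^2), m*(t*(s-t)), -e,
        ?_, by omega, ?_⟩
      · exact (hm.mul hn0).add_even (even_two_mul _)
      · subst hn hd
        constructor
        · linear_combination -1*hV + m^2*((t*(-s)*(t+-s))^2)*he2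
        · linear_combination -2*hV + m^2*(2*(t*(-s)*(t+-s))*((t*(-s)*(t+-s))-(t^3+t^2*(-s)-2*t*(-s)^2-(-s)^3)))*he2
        · linear_combination -1*hV + m^2*((((t*(-s)*(t+-s))-(t^3+t^2*(-s)-2*t*(-s)^2-(-s)^3))^2+2*(t*(-s)*(t+-s))*(-2*(t*(-s)*(t+-s))-(t^3+t^2*(-s)-2*t*(-s)^2-(-s)^3))))*he2
        · linear_combination -2*hV + m^2*((2*(t*(-s)*(t+-s))*(-(t*(-s)*(t+-s)))+2*((t*(-s)*(t+-s))-(t^3+t^2*(-s)-2*t*(-s)^2-(-s)^3))*(-2*(t*(-s)*(t+-s))-(t^3+t^2*(-s)-2*t*(-s)^2-(-s)^3))))*he2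
        · linear_combination -6*hV + m^2*(((-2*(t*(-s)*(t+-s))-(t^3+t^2*(-s)-2*t*(-s)^2-(-s)^3))^2+2*((t*(-s)*(t+-s))-(t^3+t^2*(-s)-2*t*(-s)^2-(-s)^3))*(-(t*(-s)*(t+-s)))))*he2
        · linear_combination -4*hV + m^2*(2*(-2*(t*(-s)*(t+-s))-(t^3+t^2*(-s)-2*t*(-s)^2-(-s)^3))*(-(t*(-s)*(t+-s))))*he2
        · linear_combination -1*hV + m^2*((-(t*(-s)*(t+-s)))^2)*he2
    · exfalso
      obtain ⟨k, hk⟩ : c ∣ B0*b^2 - B1*a*b + B2*a^2 := by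
        rw [← Int.pow_dvd_pow_iff two_ne_zero]
        have he2 : e^2 = 1 := by rcases he with rfl | rfl <;> norm_num
        refine ⟨e*(w0*b^4-w1*a*b^3+w2*a^2*b^2-w3*a^3*b+w4*a^4), ?_⟩
        linear_combination -e*(a^4*s4 - a^3*b*s3 + a^2*b^2*s2 - a*b^3*s1 + b^4*s0) - (B0*b^2 - B1*a*b + B2*a^2)^2*he2
      have hn : Odd (a^3+a^2*(-b)-2*a*(-b)^2-(-b)^3) := by
        apply n_odd
        rintro ⟨h1, h2⟩
        rw [dvd_neg] at h2
        exact hab 2 Nat.prime_two ⟨h1, h2, hc.two_dvd⟩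
      obtain ⟨c', hc'⟩ := hc
      obtain ⟨vv, hvv⟩ : ∃ vv, vv = v0*(-b)^3+v1*a*(-b)^2+v2*a^2*(-b)+v3*a^3 := ⟨_, rfl⟩
      obtain ⟨nn, hnn⟩ : ∃ nn, nn = a^3+a^2*(-b)-2*a*(-b)^2-(-b)^3 := ⟨_, rfl⟩
      rw [← hnn] at hn
      have ex : b*(2*vv+m*nn) + c*(w1*(-b)^3+2*w2*a*(-b)^2+3*w3*a^2*(-b)+4*w4*a^3) = 2*e*k*(B1*(-b)+2*B2*a) := by
        apply mul_left_cancel₀ c0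
        rw [hvv, hnn]
        linear_combination 4*a^3*s4 - 3*a^2*b*s3 + 2*a*b^2*s2 - b^3*s1 + 2*e*(B1*(-b)+2*B2*a)*hk
      have ez : a*(2*vv+m*nn) + c*(4*w0*(-b)^3+3*w1*a*(-b)^2+2*w2*a^2*(-b)+w3*a^3) = 2*e*k*(2*B0*(-b)+B1*a) := by
        apply mul_left_cancel₀ c0
        rw [hvv, hnn]
        linear_combination a^3*s3 - 2*a^2*b*s2 + 3*a*b^2*s1 - 4*b^3*s0 + 2*e*(2*B0*(-b)+B1*a)*hk
      have ob : Even (b*(m*nn)) := by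
        refine ⟨e*k*(B1*(-b)+2*B2*a) - b*vv - c'*(w1*(-b)^3+2*w2*a*(-b)^2+3*w3*a^2*(-b)+4*w4*a^3), ?_⟩
        rw [hc'] at ex
        linear_combination ex
      have oa : Even (a*(m*nn)) := by
        refine ⟨e*k*(2*B0*(-b)+B1*a) - a*vv - c'*(4*w0*(-b)^3+3*w1*a*(-b)^2+2*w2*a^2*(-b)+w3*a^3), ?_⟩
        rw [hc'] at ez
        linear_combination ez
      have om := hm.mul hn
      rw [← Int.not_even_iff_odd] at om
      have eb := (Int.even_mul.1 ob).resolve_right om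
      have ea := (Int.even_mul.1 oa).resolve_right om
      exact hab 2 Nat.prime_two ⟨ea.two_dvd, eb.two_dvd, ⟨c', by rw [hc']; push_cast; ring⟩⟩
  · obtain ⟨h6, h5, h4, h3, h2, h1, h0⟩ := h
    refine ⟨a*u0+c*v0, b*u0+a*u1+c*v1, b*u1+a*u2+c*v2, b*u2+c*v3, c*m, B0, B1, B2, e, hc.mul hm, he, ?_⟩
    constructor
    · linear_combination c^2*h6 + u2*s4
    · linear_combination c^2*h5 + u2*s3+u1*s4
    · linear_combination c^2*h4 + u2*s2+u1*s3+u0*s4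
    · linear_combination c^2*h3 + u2*s1+u1*s2+u0*s3
    · linear_combination c^2*h2 + u2*s0+u1*s1+u0*s2
    · linear_combination c^2*h1 + u1*s0+u0*s1
    · linear_combination c^2*h0 + u0*s0

end PNF8

section PNF9
set_option linter.unusedVariables false

/-- the set of classes -/
def InS (u0 u1 u2 : ℤ) : Prop := Prim3 u0 u1 u2 ∧
  ∃ v0 v1 v2 v3 m w0 w1 w2 w3 w4, Odd m ∧ QRel u0 u1 u2 v0 v1 v2 v3 m w0 w1 w2 w3 w4

lemma step (u0 u1 u2 : ℤ) (h : InS u0 u1 u2) :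
    ∃ v0 v1 v2 v3 m b0 b1 b2 e : ℤ, Odd m ∧ (e = 1 ∨ e = -1) ∧ InS b0 b1 b2 ∧
      QRel u0 u1 u2 v0 v1 v2 v3 m (e*b0^2) (e*(2*b0*b1)) (e*(b1^2+2*b0*b2)) (e*(2*b1*b2)) (e*b2^2) := by
  obtain ⟨hu, v0, v1, v2, v3, m, w0, w1, w2, w3, w4, hm, h⟩ := h
  obtain ⟨a, b, c, B0, B1, B2, e, hab, he, s4, s3, s2, s1, s0⟩ := step_raw _ _ _ _ _ _ _ _ _ _ _ _ _ hu hm h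
  obtain ⟨v0, v1, v2, v3, m, b0, b1, b2, e, hm, he, h⟩ :=
    step_pre _ _ _ _ _ _ _ _ _ _ _ _ _ hu hm h a b c B0 B1 B2 e hab he s4 s3 s2 s1 s0
  obtain ⟨v0, v1, v2, v3, m, b0, b1, b2, hm, hb, h⟩ := prim_B _ _ _ _ _ _ _ _ _ _ _ _ _ hm le_rfl h
  refine ⟨v0, v1, v2, v3, m, b0, b1, b2, e, hm, he, ⟨hb, v0, v1, v2, v3, m, e*(u0*b0), e*(u0*b1+u1*b0),
    e*(u0*b2+u1*b1+u2*b0), e*(u1*b2+u2*b1), e*(u2*b2), hm, ?_⟩, h⟩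
  obtain ⟨h6, h5, h4, h3, h2, h1, h0⟩ := h
  constructor
  · linear_combination h6
  · linear_combination h5
  · linear_combination h4
  · linear_combination h3
  · linear_combination h2
  · linear_combination h1
  · linear_combination h0

section
variable {R : Type*} [CommRing R]

def Good (u0 u1 u2 : R) : Prop := ∃ l : R, IsUnit l ∧
  ((u0 = l ∧ u1 = 0 ∧ u2 = 0) ∨ (u0 = 0 ∧ u1 = 0 ∧ u2 = l) ∨ (u0 = l ∧ u1 = 2*l ∧ u2 = l) ∨
   (u0 = 0 ∧ u1 = l ∧ u2 = 0) ∨ (u0 = 0 ∧ u1 = l ∧ u2 = l) ∨ (u0 = l ∧ u1 = l ∧ u2 = 0))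

lemma Good.rot {u0 u1 u2 : R} (h : Good u0 u1 u2) : Good (u0-u1+u2) (2*u0-u1) u0 := by
  obtain ⟨l, hl, h⟩ := h
  rcases h with ⟨rfl, rfl, rfl⟩ | ⟨rfl, rfl, rfl⟩ | ⟨rfl, rfl, rfl⟩ | ⟨rfl, rfl, rfl⟩ | ⟨rfl, rfl, rfl⟩ | ⟨rfl, rfl, rfl⟩
  · exact ⟨_, hl, by right; right; left; exact ⟨by ring, by ring, by ring⟩⟩
  · exact ⟨_, hl, by left; exact ⟨by ring, by ring, by ring⟩⟩
  · exact ⟨_, hl, by right; left; exact ⟨by ring, by ring, by ring⟩⟩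
  · exact ⟨_, hl.neg, by right; right; right; right; right; exact ⟨by ring, by ring, by ring⟩⟩
  · exact ⟨_, hl.neg, by right; right; right; left; exact ⟨by ring, by ring, by ring⟩⟩
  · exact ⟨_, hl, by right; right; right; right; left; exact ⟨by ring, by ring, by ring⟩⟩

lemma Good.of_rot {u0 u1 u2 : R} (h : Good (u0-u1+u2) (2*u0-u1) u0) : Good u0 u1 u2 := by
  have h := h.rot.rot
  convert h using 1 <;> ring

lemma QRel.rot {u0 u1 u2 v0 v1 v2 v3 m w0 w1 w2 w3 w4 : R} (h : QRel u0 u1 u2 v0 v1 v2 v3 m w0 w1 w2 w3 w4) :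
    QRel (u0-u1+u2) (2*u0-u1) u0 (v3-v2+v1-v0) (-v2+2*v1-3*v0) (v1-3*v0) (-v0) m
     (w0-w1+w2-w3+w4) (4*w0-3*w1+2*w2-w3) (6*w0-3*w1+w2) (4*w0-w1) w0 := by
  obtain ⟨h6, h5, h4, h3, h2, h1, h0⟩ := h
  constructor
  · linear_combination h0
  · linear_combination 6*h0 - h1
  · linear_combination 15*h0 - 5*h1 + h2
  · linear_combination 20*h0 - 10*h1+4*h2-h3
  · linear_combination 15*h0 - 10*h1+6*h2-3*h3+h4
  · linear_combination 6*h0-5*h1+4*h2-3*h3+2*h4-h5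
  · linear_combination h0-h1+h2-h3+h4-h5+h6

lemma QRel.conj {u0 u1 u2 v0 v1 v2 v3 m w0 w1 w2 w3 w4 : R} (h : QRel u0 u1 u2 v0 v1 v2 v3 m w0 w1 w2 w3 w4) :
    QRel u0 u1 u2 (m-v0) (2*m-v1) (-m-v2) (-m-v3) m w0 w1 w2 w3 w4 := by
  obtain ⟨h6, h5, h4, h3, h2, h1, h0⟩ := h
  constructor
  · linear_combination h6
  · linear_combination h5
  · linear_combination h4
  · linear_combination h3
  · linear_combination h2
  · linear_combination h1
  · linear_combination h0

lemma contract_z (hl : ∀ x y : R, x*y = 0 → IsUnit (x-y) → x = 0 ∨ y = 0)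
    {u0 u1 u2 v0 v1 v2 v3 m μ : R} (hm : IsUnit m) (hμ : IsUnit μ)
    (h : QRel u0 u1 u2 v0 v1 v2 v3 m μ 0 0 0 0) : Good u0 u1 u2 := by
  wlog k : v3 = 0 generalizing v0 v1 v2 v3
  · have h6 := h.h6
    have : v3 = 0 ∨ v3 + m = 0 := hl _ _ (by linear_combination h6) (by
      have : v3 - (v3 + m) = -m := by ring
      rw [this]; exact hm.neg)
    rcases this with h3 | h3
    · exact this h h3
    · exact this h.conj (by linear_combination -h3)
  · obtain ⟨h6, h5, h4, h3, h2, h1, h0⟩ := h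
    subst k
    have k2 : v2 = 0 := hm.mul_left_cancel (by linear_combination h5)
    subst k2
    have k1 : v1 = m := hm.mul_left_cancel (by linear_combination h4)
    subst k1
    have k0 : v0 = v1 := hm.mul_left_cancel (by linear_combination h3)
    subst k0
    obtain ⟨μ, rfl⟩ := hμ
    have e : (↑μ⁻¹ : R) * μ = 1 := by simp
    refine ⟨-v0^2*↑μ⁻¹, ((hm.pow 2).neg).mul (Units.isUnit _), ?_⟩
    right; right; right; right; left
    refine ⟨?_, ?_, ?_⟩
    · linear_combination -u0*e - ↑μ⁻¹*h0
    · linear_combination -u1*e - ↑μ⁻¹*h1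
    · linear_combination -u2*e - ↑μ⁻¹*h2

lemma contract_xz (hl : ∀ x y : R, x*y = 0 → IsUnit (x-y) → x = 0 ∨ y = 0)
    {u0 u1 u2 v0 v1 v2 v3 m μ : R} (hm : IsUnit m) (hμ : IsUnit μ)
    (h : QRel u0 u1 u2 v0 v1 v2 v3 m 0 0 μ 0 0) : Good u0 u1 u2 := by
  wlog k : v3 = 0 generalizing v0 v1 v2 v3
  · have h6 := h.h6
    have : v3 = 0 ∨ v3 + m = 0 := hl _ _ (by linear_combination h6) (by
      have : v3 - (v3 + m) = -m := by ring
      rw [this]; exact hm.neg)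
    rcases this with h3 | h3
    · exact this h h3
    · exact this h.conj (by linear_combination -h3)
  · obtain ⟨h6, h5, h4, h3, h2, h1, h0⟩ := h
    subst k
    have k2 : v2 = 0 := hm.mul_left_cancel (by linear_combination h5)
    subst k2
    obtain ⟨μ, rfl⟩ := hμ
    have e : (↑μ⁻¹ : R) * μ = 1 := by simp
    have : v0 = 0 ∨ v0 - m = 0 := hl _ _ (by linear_combination h0) (by
      have : v0 - (v0 - m) = m := by ring
      rw [this]; exact hm)
    rcases this with k0 | k0
    · subst k0
      have k1 : v1 = 0 := hm.mul_left_cancel (by linear_combination -h1)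
      subst k1
      refine ⟨-m^2*↑μ⁻¹, ((hm.pow 2).neg).mul (Units.isUnit _), ?_⟩
      right; right; left
      refine ⟨?_, ?_, ?_⟩
      · linear_combination -u0*e - ↑μ⁻¹*h2
      · linear_combination -u1*e - ↑μ⁻¹*h3
      · linear_combination -u2*e - ↑μ⁻¹*h4
    · have k0 : v0 = m := by linear_combination k0
      subst k0
      have k1 : v1 = 2*v0 := hm.mul_left_cancel (by linear_combination h1)
      subst k1
      refine ⟨v0^2*↑μ⁻¹, (hm.pow 2).mul (Units.isUnit _), ?_⟩
      right; right; right; right; left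
      refine ⟨?_, ?_, ?_⟩
      · linear_combination -u0*e - ↑μ⁻¹*h2
      · linear_combination -u1*e - ↑μ⁻¹*h3
      · linear_combination -u2*e - ↑μ⁻¹*h4

lemma contract (hl : ∀ x y : R, x*y = 0 → IsUnit (x-y) → x = 0 ∨ y = 0)
    {u0 u1 u2 v0 v1 v2 v3 m e b0 b1 b2 : R} (hm : IsUnit m) (he : IsUnit e) (hb : Good b0 b1 b2)
    (h : QRel u0 u1 u2 v0 v1 v2 v3 m (e*b0^2) (e*(2*b0*b1)) (e*(b1^2+2*b0*b2)) (e*(2*b1*b2)) (e*b2^2)) :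
    Good u0 u1 u2 := by
  obtain ⟨l, hll, hb⟩ := hb
  have hμ : IsUnit (e*l^2) := he.mul (hll.pow 2)
  rcases hb with ⟨rfl, rfl, rfl⟩ | ⟨rfl, rfl, rfl⟩ | ⟨rfl, rfl, rfl⟩ | ⟨rfl, rfl, rfl⟩ | ⟨rfl, rfl, rfl⟩ | ⟨rfl, rfl, rfl⟩
  · exact contract_z hl hm hμ (by convert h using 1 <;> ring)
  · exact (contract_z hl hm hμ (by convert h.rot using 1 <;> ring)).of_rot
  · exact (contract_z hl hm hμ (by convert h.rot.rot using 1 <;> ring)).of_rot.of_rot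
  · exact contract_xz hl hm hμ (by convert h using 1 <;> ring)
  · exact (contract_xz hl hm hμ (by convert h.rot using 1 <;> ring)).of_rot
  · exact (contract_xz hl hm hμ (by convert h.rot.rot using 1 <;> ring)).of_rot.of_rot
end

lemma odd_isUnit (k : ℕ) {m : ℤ} (hm : Odd m) : IsUnit (m : ZMod (2^k)) := by
  have h : IsCoprime m ((2:ℤ)^k) := by
    apply IsCoprime.pow_right
    obtain ⟨j, rfl⟩ := hm
    exact ⟨1, -j, by ring⟩
  obtain ⟨a, b, hab⟩ := h
  have : ((a * m + b * 2^k : ℤ) : ZMod (2^k)) = 1 := by rw [hab]; simp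
  push_cast at this
  have z : ((2:ZMod (2^k))^k) = 0 := by
    have := ZMod.natCast_self (2^k)
    push_cast at this
    exact this
  rw [z, mul_zero, add_zero] at this
  exact IsUnit.of_mul_eq_one _ (by rw [mul_comm]; exact this)

lemma isUnit_odd (k : ℕ) {m : ℤ} (hm : IsUnit (m : ZMod (2^(k+1)))) : Odd m := by
  rw [← Int.not_even_iff_odd]
  intro he
  obtain ⟨j, rfl⟩ := he
  have z : ((2:ZMod (2^(k+1)))^(k+1)) = 0 := by
    have := ZMod.natCast_self (2^(k+1))
    push_cast at this
    exact this
  have h2 := hm.pow (k+1)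
  have : ((j+j:ℤ) : ZMod (2^(k+1)))^(k+1) = 0 := by
    push_cast
    rw [← two_mul, mul_pow, z, zero_mul]
  rw [this] at h2
  have : Nontrivial (ZMod (2^(k+1))) := ZMod.nontrivial_iff.2 (by
    have := Nat.one_lt_two_pow (n := k+1) (by omega)
    omega)
  exact not_isUnit_zero h2

lemma zmod_hl (k : ℕ) (x y : ZMod (2^(k+1))) (h : x*y = 0) (hu : IsUnit (x-y)) : x = 0 ∨ y = 0 := by
  obtain ⟨x, rfl⟩ := ZMod.intCast_surjective x
  obtain ⟨y, rfl⟩ := ZMod.intCast_surjective y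
  have ho := isUnit_odd k (m := x - y) (by push_cast; exact hu)
  rcases Int.even_or_odd x with hx | hx
  · left
    have hy : Odd y := by
      have := hx.sub_odd ho
      simpa using this
    exact (odd_isUnit (k+1) hy).mul_right_cancel (by rw [h, zero_mul])
  · right
    exact (odd_isUnit (k+1) hx).mul_left_cancel (by rw [h, mul_zero])

lemma zm_lift (M : ℕ) {a b : ℤ} (h : (a : ZMod M) = b) : ∃ r : ℤ, a = b + M * r := by
  have : ((a - b : ℤ) : ZMod M) = 0 := by push_cast; rw [h, sub_self]
  rw [zm_dvd] at this
  obtain ⟨r, hr⟩ := this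
  exact ⟨r, by linear_combination hr⟩

lemma good_lift (k : ℕ) (b0 b1 b2 : ℤ) (h : Good (b0 : ZMod (2^(k+1))) b1 b2) :
    ∃ g0 g1 g2 r0 r1 r2 : ℤ, b0 = g0 + 2^(k+1)*r0 ∧ b1 = g1 + 2^(k+1)*r1 ∧ b2 = g2 + 2^(k+1)*r2 ∧
      Good (g0 : ZMod (2^(k+2))) g1 g2 := by
  obtain ⟨l, hl, h⟩ := h
  obtain ⟨l, rfl⟩ := ZMod.intCast_surjective l
  have hl := odd_isUnit (k+2) (isUnit_odd k hl)
  have key : ∃ g0 g1 g2 : ℤ, (b0 : ZMod (2^(k+1))) = g0 ∧ (b1 : ZMod (2^(k+1))) = g1 ∧ (b2 : ZMod (2^(k+1))) = g2 ∧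
     Good (g0 : ZMod (2^(k+2))) g1 g2 := by
    rcases h with ⟨e0, e1, e2⟩ | ⟨e0, e1, e2⟩ | ⟨e0, e1, e2⟩ | ⟨e0, e1, e2⟩ | ⟨e0, e1, e2⟩ | ⟨e0, e1, e2⟩
    · exact ⟨l, 0, 0, by simpa using e0, by simpa using e1, by simpa using e2, l, hl, by simp⟩
    · exact ⟨0, 0, l, by simpa using e0, by simpa using e1, by simpa using e2, l, hl, by simp⟩
    · exact ⟨l, 2*l, l, by simpa using e0, by simpa using e1, by simpa using e2, l, hl, by simp⟩
    · exact ⟨0, l, 0, by simpa using e0, by simpa using e1, by simpa using e2, l, hl, by simp⟩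
    · exact ⟨0, l, l, by simpa using e0, by simpa using e1, by simpa using e2, l, hl, by simp⟩
    · exact ⟨l, l, 0, by simpa using e0, by simpa using e1, by simpa using e2, l, hl, by simp⟩
  obtain ⟨g0, g1, g2, e0, e1, e2, hg⟩ := key
  obtain ⟨r0, h0⟩ := zm_lift _ e0
  obtain ⟨r1, h1⟩ := zm_lift _ e1
  obtain ⟨r2, h2⟩ := zm_lift _ e2
  push_cast at h0 h1 h2
  exact ⟨g0, g1, g2, r0, r1, r2, h0, h1, h2, hg⟩

lemma base_check : ∀ u0 u1 u2 : ZMod 2, ¬ (u0 = 0 ∧ u1 = 0 ∧ u2 = 0) → ¬ (u0 = 1 ∧ u1 = 1 ∧ u2 = 1) →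
   ((u0 = 1 ∧ u1 = 0 ∧ u2 = 0) ∨ (u0 = 0 ∧ u1 = 0 ∧ u2 = 1) ∨ (u0 = 1 ∧ u1 = 2*1 ∧ u2 = 1) ∨
   (u0 = 0 ∧ u1 = 1 ∧ u2 = 0) ∨ (u0 = 0 ∧ u1 = 1 ∧ u2 = 1) ∨ (u0 = 1 ∧ u1 = 1 ∧ u2 = 0)) := by decide

lemma base_no' : ∀ v0 v1 v2 v3 w2 : ZMod 2,
   v2^2 + (v1+v2) - 1 = w2+(v2+v3-(v3^2+v3))+(v3^2+v3) → (v0+v1-v3) = (-v1-(v0^2-v0))+w2+(v2+v3-(v3^2+v3)) →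
   v1^2 + (v0-v2) - 1 = (v0^2-v0)+(-v1-(v0^2-v0))+w2 → False := by decide

lemma base_no (v0 v1 v2 v3 w0 w1 w2 w3 w4 : ZMod 2) (h6 : v3^2 + v3 = w4) (h5 : v2+v3 = w3+w4)
   (h4 : v2^2 + (v1+v2) - 1 = w2+w3+w4) (h3 : (v0+v1-v3) = w1+w2+w3) (h2 : v1^2 + (v0-v2) - 1 = w0+w1+w2)
   (h1 : -v1 = w0+w1) (h0 : v0^2 - v0 = w0) : False := by
  subst h6 h0
  obtain rfl : w3 = v2+v3-(v3^2+v3) := by linear_combination -h5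
  obtain rfl : w1 = -v1-(v0^2-v0) := by linear_combination -h1
  exact base_no' _ _ _ _ _ h4 h3 h2

lemma good_base (u0 u1 u2 : ℤ) (h : InS u0 u1 u2) : Good (u0 : ZMod 2) u1 u2 := by
  obtain ⟨hu, v0, v1, v2, v3, m, w0, w1, w2, w3, w4, hm, h⟩ := h
  refine ⟨1, isUnit_one, base_check _ _ _ ?_ ?_⟩
  · have := hu 2 Nat.prime_two
    rw [← zm_dvd, ← zm_dvd, ← zm_dvd] at this
    exact this
  · rintro ⟨h0, h1, h2⟩
    have h' := h.map (Int.castRingHom (ZMod 2))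
    simp only [eq_intCast] at h'
    have hm1 : (m : ZMod 2) = 1 := by
      obtain ⟨j, rfl⟩ := hm
      have : (2 : ZMod 2) = 0 := rfl
      push_cast
      rw [this]; simp
    rw [h0, h1, h2, hm1] at h'
    obtain ⟨h6, h5, h4, h3, h2, h1, h0⟩ := h'
    have z : (2 : ZMod 2) = 0 := rfl
    exact base_no v0 v1 v2 v3 w0 w1 w2 w3 w4 (by linear_combination h6) (by linear_combination h5 - v3*v2*z)
      (by linear_combination h4 - (v3*v1-v3)*z) (by linear_combination h3 - (v3*v0+v2*v1-v2-1)*z)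
      (by linear_combination h2 - (v2*v0-v1)*z) (by linear_combination h1 - (v1*v0-v0)*z) (by linear_combination h0)

lemma good_all (k : ℕ) : ∀ u0 u1 u2 : ℤ, InS u0 u1 u2 → Good (u0 : ZMod (2^(k+1))) u1 u2 := by
  induction k with
  | zero => exact good_base
  | succ k ih =>
    intro u0 u1 u2 hu
    obtain ⟨v0, v1, v2, v3, m, b0, b1, b2, e, hm, he, hb, h⟩ := step _ _ _ hu
    obtain ⟨g0, g1, g2, r0, r1, r2, rfl, rfl, rfl, hg⟩ := good_lift k _ _ _ (ih _ _ _ hb)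
    have h' := h.map (Int.castRingHom (ZMod (2^(k+2))))
    simp only [eq_intCast] at h'
    push_cast at h'
    have z : ((2:ZMod (2^(k+2)))^(k+2)) = 0 := by
      have := ZMod.natCast_self (2^(k+2))
      push_cast at this
      exact this
    have z1 : 2*((2:ZMod (2^(k+2)))^(k+1)) = 0 := by rw [← z]; ring
    have z2 : ((2:ZMod (2^(k+2)))^(k+1))^2 = 0 := by
      rw [← pow_mul, show (k+1)*2 = (k+2)+k by ring, pow_add _ (k+2) k, z, zero_mul]
    have heu : IsUnit (e : ZMod (2^(k+2))) := odd_isUnit _ (by rcases he with rfl | rfl <;> decide)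
    refine contract (v0 := v0) (v1 := v1) (v2 := v2) (v3 := v3) (zmod_hl (k+1)) (odd_isUnit _ hm) heu hg ?_
    generalize (2:ZMod (2^(k+2)))^(k+1) = N at *
    convert h' using 1
    · linear_combination -e*(g0*r0*z1 + r0^2*z2)
    · linear_combination -e*((g0*r1+g1*r0)*z1 + 2*r0*r1*z2)
    · linear_combination -e*((g1*r1+g0*r2+g2*r0)*z1 + (2*r0*r2+r1^2)*z2)
    · linear_combination -e*((g1*r2+g2*r1)*z1 + 2*r1*r2*z2)
    · linear_combination -e*(g2*r2*z1 + r2^2*z2)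

lemma quintic_div {r s : ℤ} (hs : s ≠ 0) (hrs : IsCoprime r s) (c0 c1 c2 c3 c4 c5 : ℤ)
    (h : c5*r^5+c4*r^4*s+c3*r^3*s^2+c2*r^2*s^3+c1*r*s^4+c0*s^5 = 0) :
    ∃ w0 w1 w2 w3 w4 : ℤ, s*w4 = c5 ∧ s*w3-r*w4 = c4 ∧ s*w2-r*w3=c3 ∧ s*w1-r*w2=c2 ∧ s*w0-r*w1=c1 ∧ -r*w0=c0 := by
  have hd : ∀ (c : ℤ) (j : ℕ), s ∣ c*r^j → s ∣ c := fun c j hc => (hrs.symm.pow_right (n := j)).dvd_of_dvd_mul_right hc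
  obtain ⟨w4, rfl⟩ := hd c5 5 ⟨-(c4*r^4+c3*r^3*s+c2*r^2*s^2+c1*r*s^3+c0*s^4), by linear_combination h⟩
  have h : (w4*r+c4)*r^4+c3*r^3*s+c2*r^2*s^2+c1*r*s^3+c0*s^4 = 0 := by
    apply mul_left_cancel₀ hs; linear_combination h
  obtain ⟨w3, h3⟩ := hd (w4*r+c4) 4 ⟨-(c3*r^3+c2*r^2*s+c1*r*s^2+c0*s^3), by linear_combination h⟩
  rw [h3] at h
  have h : (w3*r+c3)*r^3+c2*r^2*s+c1*r*s^2+c0*s^3 = 0 := by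
    apply mul_left_cancel₀ hs; linear_combination h
  obtain ⟨w2, h2⟩ := hd (w3*r+c3) 3 ⟨-(c2*r^2+c1*r*s+c0*s^2), by linear_combination h⟩
  rw [h2] at h
  have h : (w2*r+c2)*r^2+c1*r*s+c0*s^2 = 0 := by
    apply mul_left_cancel₀ hs; linear_combination h
  obtain ⟨w1, h1⟩ := hd (w2*r+c2) 2 ⟨-(c1*r+c0*s), by linear_combination h⟩
  rw [h1] at h
  have h : (w1*r+c1)*r+c0*s = 0 := by
    apply mul_left_cancel₀ hs; linear_combination h
  obtain ⟨w0, h0⟩ := hd (w1*r+c1) 1 ⟨-c0, by linear_combination h⟩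
  rw [h0] at h
  have h : w0*r+c0 = 0 := by
    apply mul_left_cancel₀ hs; linear_combination h
  exact ⟨w0, w1, w2, w3, w4, rfl, by linear_combination -h3, by linear_combination -h2, by linear_combination -h1,
    by linear_combination -h0, by linear_combination -h⟩

lemma start_odd {p q r s : ℤ} (hrs : IsCoprime r s) (hs : Odd s)
    (h1 : p^2-q^2 = r^3+r^2*s-2*r*s^2-s^3) (h2 : p*q = r*s*(r+s)) : r*s*(r+s) = 0 := by
  have hs0 : s ≠ 0 := by rintro rfl; simp at hs
  obtain ⟨x, y, hxy⟩ : IsCoprime (r^2) (s^2) := hrs.pow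
  obtain ⟨α, hα⟩ : ∃ α, α = q^2*x := ⟨_, rfl⟩
  obtain ⟨β, hβ⟩ : ∃ β, β = q^2*y := ⟨_, rfl⟩
  have hab : α*r^2+β*s^2 = q^2 := by rw [hα, hβ]; linear_combination q^2*hxy
  clear hα hβ
  obtain ⟨w0, w1, w2, w3, w4, e5, e4, e3, e2, e1, e0⟩ := quintic_div hs0 hrs (β^2-s*β) (-2*s*β) (2*α*β+s*(β-α)-s^2)
    (s*(β-2*α)-2*s^2) (α^2+s*α-s^2) (s*α) (by
      apply mul_left_cancel₀ hs0
      linear_combination s^2*((α*r^2+β*s^2+q^2+(r^3+r^2*s-2*r*s^2-s^3))*hab - q^2*h1 + (p*q+r*s*(r+s))*h2))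
  have hS : InS (-r) s 0 := by
    refine ⟨?_, β, 0, α, 0, s, w0, w1, w2, w3, w4, hs, ⟨?_, ?_, ?_, ?_, ?_, ?_, ?_⟩⟩
    · rintro p hp ⟨k1, k2, -⟩
      rw [dvd_neg] at k1
      obtain ⟨a, b, hab⟩ := hrs
      have : (p:ℤ) ∣ 1 := by rw [← hab]; exact dvd_add (Dvd.dvd.mul_left k1 _) (Dvd.dvd.mul_left k2 _)
      exact hp.one_lt.ne' (by exact_mod_cast Int.eq_one_of_dvd_one (by positivity) this)
    · ring
    · linear_combination -e5
    · linear_combination -e4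
    · linear_combination -e3
    · linear_combination -e2
    · linear_combination -e1
    · linear_combination -e0
  by_contra hne
  have key : ∀ k : ℕ, (2:ℤ)^(k+1) ∣ r*s*(r+s) := by
    intro k
    obtain ⟨l, -, h⟩ := good_all k _ _ _ hS
    have : ((r*s*(r+s) : ℤ) : ZMod (2^(k+1))) = 0 := by
      push_cast at h ⊢
      rcases h with ⟨k0, k1, k2⟩ | ⟨k0, k1, k2⟩ | ⟨k0, k1, k2⟩ | ⟨k0, k1, k2⟩ | ⟨k0, k1, k2⟩ | ⟨k0, k1, k2⟩
      · rw [k1]; ring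
      · rw [k1]; ring
      · rw [k1, ← k2]; ring
      · rw [neg_eq_zero.1 k0]; ring
      · rw [neg_eq_zero.1 k0]; ring
      · rw [k1, ← k0]; ring
    rw [zm_dvd] at this
    exact_mod_cast this
  have h3 := key (r*s*(r+s)).natAbs
  have h4 : 2^((r*s*(r+s)).natAbs+1) ∣ (r*s*(r+s)).natAbs := by
    have := Int.natAbs_dvd_natAbs.2 h3
    simpa [Int.natAbs_pow] using this
  have h5 := Nat.le_of_dvd (Int.natAbs_pos.2 hne) h4
  have h6 := Nat.lt_two_pow_self (n := (r*s*(r+s)).natAbs+1)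
  omega

lemma start {p q r s : ℤ} (hrs : IsCoprime r s)
    (h1 : p^2-q^2 = r^3+r^2*s-2*r*s^2-s^3) (h2 : p*q = r*s*(r+s)) : r*s*(r+s) = 0 := by
  rcases Int.even_or_odd s with hs | hs
  · have hr : Odd r := by
      rw [← Int.not_even_iff_odd]
      intro hr
      obtain ⟨a, b, hab⟩ := hrs
      have : Even (1:ℤ) := by rw [← hab]; exact (hr.mul_left a).add (hs.mul_left b)
      exact absurd this (by decide)
    have h := start_odd (p := p) (q := q) (r := s) (s := -r-s) (by
      obtain ⟨a, b, hab⟩ := hrs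
      exact ⟨b-a, -a, by linear_combination hab⟩) (by exact hr.neg.sub_even hs)
      (by linear_combination h1) (by linear_combination h2)
    linear_combination h
  · exact start_odd hrs hs h1 h2

end PNF9

section PNF10
set_option linter.unusedVariables false

lemma main_pt (a z : ℚ) (hz : z ≠ 0) (hb : a + 1 ≠ 0)
    (h : a^3*z^3 - a^3*z^2 + 3*a^2*z^3 - 2*a^2*z + 3*a*z^3 + 2*a*z^2 - 2*a*z - a + z^3 + 2*z^2 - z - 1 = 0) : False := by
  obtain ⟨b, hbd⟩ : ∃ b, b = a + 1 := ⟨_, rfl⟩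
  obtain ⟨x, hx⟩ : ∃ x, x = a + z⁻¹ := ⟨_, rfl⟩
  have hzz : z * z⁻¹ = 1 := mul_inv_cancel₀ hz
  have key : (x^3+x^2-2*x-1)*b = x*(x+1)*(b^2-1) := by
    rw [hx, hbd]
    apply mul_left_cancel₀ (pow_ne_zero 3 hz)
    generalize z⁻¹ = y at hzz
    have hy : y = z⁻¹ := eq_inv_of_mul_eq_one_right hzz
    subst hy
    field_simp
    linear_combination -h
  rw [← hbd] at hb
  have hpq : IsCoprime b.num (b.den:ℤ) := by
    rw [Int.isCoprime_iff_gcd_eq_one]; exact b.reduced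
  have hrs : IsCoprime x.num (x.den:ℤ) := by
    rw [Int.isCoprime_iff_gcd_eq_one]; exact x.reduced
  have hp0 : b.num ≠ 0 := Rat.num_ne_zero.2 hb
  have hq0 : (b.den:ℤ) ≠ 0 := by exact_mod_cast b.den_nz
  have hs0 : (x.den:ℤ) ≠ 0 := by exact_mod_cast x.den_nz
  have hbe : b = (b.num:ℚ) / ((b.den:ℤ):ℚ) := by exact_mod_cast (Rat.num_div_den b).symm
  have hxe : x = (x.num:ℚ) / ((x.den:ℤ):ℚ) := by exact_mod_cast (Rat.num_div_den x).symm
  generalize b.num = p at *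
  generalize (b.den:ℤ) = q at *
  generalize x.num = r at *
  generalize (x.den:ℤ) = s at *
  have hqQ : (q:ℚ) ≠ 0 := by exact_mod_cast hq0
  have hsQ : (s:ℚ) ≠ 0 := by exact_mod_cast hs0
  have k : (p^2-q^2)*(r*s*(r+s)) = (p*q)*(r^3+r^2*s-2*r*s^2-s^3) := by
    have hp' : (p:ℚ) = b*q := by rw [hbe]; field_simp
    have hr' : (r:ℚ) = x*s := by rw [hxe]; field_simp
    have : ((p:ℚ)^2-q^2)*(r*s*(r+s)) = (p*q)*(r^3+r^2*s-2*r*s^2-s^3) := by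
      rw [hp', hr']
      linear_combination -s^3*q^2*key
    exact_mod_cast this
  have c1 : IsCoprime (p^2-q^2) (p*q) := by
    apply IsCoprime.mul_right
    · have : IsCoprime (-q^2) p := (hpq.symm.pow_left (m := 2)).neg_left
      have := IsCoprime.add_mul_left_left this p
      rwa [show -q^2 + p*p = p^2-q^2 by ring] at this
    · have : IsCoprime (p^2) q := hpq.pow_left (m := 2)
      have := IsCoprime.add_mul_left_left this (-q)
      rwa [show p^2 + q*(-q) = p^2-q^2 by ring] at this
  have c2 : IsCoprime (r^3+r^2*s-2*r*s^2-s^3) (r*s*(r+s)) := by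
    apply IsCoprime.mul_right
    apply IsCoprime.mul_right
    · have : IsCoprime (-s^3) r := (hrs.symm.pow_left (m := 3)).neg_left
      have := IsCoprime.add_mul_left_left this (r^2+r*s-2*s^2)
      rwa [show -s^3 + r*(r^2+r*s-2*s^2) = r^3+r^2*s-2*r*s^2-s^3 by ring] at this
    · have : IsCoprime (r^3) s := hrs.pow_left (m := 3)
      have := IsCoprime.add_mul_left_left this (r^2-2*r*s-s^2)
      rwa [show r^3 + s*(r^2-2*r*s-s^2) = r^3+r^2*s-2*r*s^2-s^3 by ring] at this
    · have h0 : IsCoprime s (r+s) := by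
        obtain ⟨u, v, huv⟩ := hrs
        exact ⟨v-u, u, by linear_combination huv⟩
      have : IsCoprime (s^3) (r+s) := h0.pow_left (m := 3)
      have := IsCoprime.add_mul_left_left this (r^2-2*s^2)
      rwa [show s^3 + (r+s)*(r^2-2*s^2) = r^3+r^2*s-2*r*s^2-s^3 by ring] at this
  have hodd : Odd (r^3+r^2*s-2*r*s^2-s^3) := by
    apply n_odd
    rintro ⟨h1, h2⟩
    obtain ⟨u, v, huv⟩ := hrs
    have : (2:ℤ) ∣ 1 := by rw [← huv]; exact dvd_add (Dvd.dvd.mul_left h1 _) (Dvd.dvd.mul_left h2 _)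
    omega
  have d1 : (p^2-q^2) ∣ (r^3+r^2*s-2*r*s^2-s^3) := c1.dvd_of_dvd_mul_left ⟨_, k.symm⟩
  have d2 : (r^3+r^2*s-2*r*s^2-s^3) ∣ (p^2-q^2) := c2.dvd_of_dvd_mul_right ⟨p*q, by rw [k]; ring⟩
  have hA : p^2-q^2 ≠ 0 := by
    intro h0
    rw [h0, zero_dvd_iff] at d1
    rw [d1] at hodd
    simp at hodd
  have hfin : p*q = 0 := by
    rcases Int.associated_iff.1 (associated_of_dvd_dvd d1 d2) with e | e
    · have hD : p*q = r*s*(r+s) := by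
        apply mul_left_cancel₀ hA; rw [k, ← e]; ring
      rw [hD]; exact start hrs e hD
    · have hD : q*(-p) = r*s*(r+s) := by
        apply mul_left_cancel₀ hA; linear_combination -p*q*e - k
      have := start (p := q) (q := -p) hrs (by linear_combination -e) hD
      rw [this] at hD; linear_combination -hD
  rcases mul_eq_zero.1 hfin with h0 | h0
  · exact hp0 h0
  · exact hq0 h0


end PNF10

theorem stmt_16 :
    ({p : ℚ × ℚ |
        p.1 ^ 3 * p.2 ^ 3 - p.1 ^ 3 * p.2 ^ 2 + 3 * p.1 ^ 2 * p.2 ^ 3 -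
          2 * p.1 ^ 2 * p.2 + 3 * p.1 * p.2 ^ 3 + 2 * p.1 * p.2 ^ 2 -
          2 * p.1 * p.2 - p.1 + p.2 ^ 3 + 2 * p.2 ^ 2 - p.2 - 1 = 0} =
      ({(-1, 0), (-1, 1)} : Set (ℚ × ℚ))) ∧
    ∀ a : ℚ, a ≠ 0 → a ≠ -1 → a ≠ -2 →
      ¬ ∃ z₁ z₂ z₃ : ℚ,
        z₁ ≠ 0 ∧ z₁ ≠ 1 ∧ z₂ ≠ 0 ∧ z₂ ≠ 1 ∧ z₃ ≠ 0 ∧ z₃ ≠ 1 ∧ z₁ ≠ z₂ ∧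
        ((a + 1) * z₁ ^ 2 - a * z₁ - 1) / ((a + 1) * z₁ ^ 2) = z₂ ∧
        ((a + 1) * z₂ ^ 2 - a * z₂ - 1) / ((a + 1) * z₂ ^ 2) = z₃ ∧
        ((a + 1) * z₃ ^ 2 - a * z₃ - 1) / ((a + 1) * z₃ ^ 2) = z₁ := by
  have main : ∀ a z : ℚ, a^3*z^3 - a^3*z^2 + 3*a^2*z^3 - 2*a^2*z + 3*a*z^3 + 2*a*z^2 - 2*a*z - a + z^3 + 2*z^2 - z - 1 = 0 →
      a = -1 ∧ (z = 0 ∨ z = 1) := by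
    intro a z h
    have ha : a = -1 := by
      by_cases hz : z = 0
      · subst hz; linear_combination -h
      · by_contra ha
        exact main_pt a z hz (fun h0 => ha (by linear_combination h0)) h
    subst ha
    refine ⟨rfl, ?_⟩
    have : z * (z - 1) = 0 := by linear_combination h
    rcases mul_eq_zero.1 this with h0 | h0
    · exact Or.inl h0
    · exact Or.inr (by linear_combination h0)
  constructor
  · ext ⟨a, z⟩
    simp only [Set.mem_ofPred_eq, Set.mem_insert_iff, Set.mem_singleton_iff, Prod.mk.injEq]
    constructor
    · intro h
      obtain ⟨rfl, h⟩ := main a z h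
      tauto
    · rintro (⟨rfl, rfl⟩ | ⟨rfl, rfl⟩) <;> norm_num
  · rintro a - ha - ⟨z₁, z₂, z₃, h10, h11, h20, h21, h30, h31, hne, e1, e2, e3⟩
    have hb : a + 1 ≠ 0 := fun h0 => ha (by linear_combination h0)
    obtain ⟨N1, hN1⟩ : ∃ N, N = (a + 1) * z₁ ^ 2 - a * z₁ - 1 := ⟨_, rfl⟩
    obtain ⟨D1, hD1⟩ : ∃ D, D = (a + 1) * z₁ ^ 2 := ⟨_, rfl⟩
    have hD10 : D1 ≠ 0 := by rw [hD1]; exact mul_ne_zero hb (pow_ne_zero 2 h10)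
    have f1 : N1 = z₂ * D1 := by
      rw [← hN1, ← hD1] at e1
      rw [← e1]; field_simp
    have f2 : (a + 1) * z₂ ^ 2 - a * z₂ - 1 = z₃ * ((a + 1) * z₂ ^ 2) := by
      rw [← e2]; field_simp
    have f3 : (a + 1) * z₃ ^ 2 - a * z₃ - 1 = z₁ * ((a + 1) * z₃ ^ 2) := by
      rw [← e3]; field_simp
    obtain ⟨N2, hN2⟩ : ∃ N, N = (a + 1) * N1 ^ 2 - a * N1 * D1 - D1^2 := ⟨_, rfl⟩
    obtain ⟨D2, hD2⟩ : ∃ D, D = (a + 1) * N1 ^ 2 := ⟨_, rfl⟩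
    have g2 : N2 = z₃ * D2 := by
      rw [hN2, hD2, f1]; linear_combination D1^2*f2
    have g3 : (a + 1) * N2 ^ 2 - a * N2 * D2 - D2^2 - z₁ * (a + 1) * N2 ^ 2 = 0 := by
      rw [g2]; linear_combination D2^2*f3
    have g1 : N1 - z₁ * D1 ≠ 0 := by
      rw [f1, ← sub_mul]
      exact mul_ne_zero (sub_ne_zero.2 hne.symm) hD10
    have hprod : (a+1)^2 * (N1 - z₁ * D1) * z₁ * (z₁ - 1) * (a^3*z₁^3 - a^3*z₁^2 + 3*a^2*z₁^3 - 2*a^2*z₁ + 3*a*z₁^3 + 2*a*z₁^2 - 2*a*z₁ - a + z₁^3 + 2*z₁^2 - z₁ - 1) = 0 := by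
      rw [← g3, hN2, hD2, hN1, hD1]; ring
    have hc : (a+1)^2 * (N1 - z₁ * D1) * z₁ * (z₁ - 1) ≠ 0 :=
      mul_ne_zero (mul_ne_zero (mul_ne_zero (pow_ne_zero 2 hb) g1) h10) (sub_ne_zero.2 h11)
    have := main a z₁ ((mul_eq_zero.1 hprod).resolve_left hc)
    exact ha this.1
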